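/- Fix d ≥ 1, T > 0, a compact interval Θ = [θ_min, θ_max] ⊂ (0,∞), a link function Φ, a smooth ℤ^d-periodic initial value u_0, an integer β > 2 + d/2, and R > 0. There exists a constant C(R) > 0 such that: for all θ₁, θ₂ ∈ Θ and all smooth ℤ^d-periodic F₁, F₂ with ‖F₁‖_{H^β(𝕋^d)} ≤ R and ‖F₂‖_{H^β(𝕋^d)} ≤ R, if u₁ and u₂ are smooth classical solutions with diffusivities θ₁, θ₂, absorptions Φ∘F₁, Φ∘F₂ and common initial value u_0, then ‖u₁ − u₂‖_{L²(Q)} ≤ C(R)(|θ₁ − θ₂| + ‖F₁ − F₂‖_{(H²)*}). (Lemma 'Lipschitz Condition': joint Lipschitz estimate for the forward map (θ,F) ↦ K_θF.) -/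

import Mathlib

open MeasureTheory Real Filter

noncomputable section

/-- Partial derivative in the `i`-th spatial coordinate. -/
def pder {d : ℕ} (i : Fin d) (v : (Fin d → ℝ) → ℝ) : (Fin d → ℝ) → ℝ :=
  fun x => deriv (fun s => v (Function.update x i s)) (x i)

/-- Spatial Laplacian `Δ_x = ∑ᵢ ∂²/∂xᵢ²`. -/
def lap {d : ℕ} (v : (Fin d → ℝ) → ℝ) : (Fin d → ℝ) → ℝ :=
  fun x => ∑ i : Fin d, pder i (pder i v) x

/-- Multi-index spatial derivative `∂^j`. -/
def mder {d : ℕ} (j : Fin d → ℕ) (v : (Fin d → ℝ) → ℝ) : (Fin d → ℝ) → ℝ :=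
  (List.finRange d).foldr (fun i acc => (pder i)^[j i] acc) v

/-- `ℤ^d`-periodicity of a function on `ℝ^d`. -/
def ZPer {d : ℕ} (F : (Fin d → ℝ) → ℝ) : Prop :=
  ∀ (x : Fin d → ℝ) (k : Fin d → ℤ), F (fun i => x i + (k i : ℝ)) = F x

/-- `ℤ^d`-periodicity in the space variable. -/
def ZPerSpace {d : ℕ} (u : (Fin d → ℝ) → ℝ → ℝ) : Prop :=
  ∀ t : ℝ, ZPer fun x => u x t

/-- The fundamental domain `[0,1]^d` of the torus. -/
def unitCube (d : ℕ) : Set (Fin d → ℝ) := Set.Icc 0 1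

/-- `L²`-norm on the torus. -/
def l2T {d : ℕ} (F : (Fin d → ℝ) → ℝ) : ℝ :=
  Real.sqrt (∫ x in unitCube d, (F x) ^ 2)

/-- `L²`-norm on `Q = 𝕋^d × (0,T)`. -/
def l2Q {d : ℕ} (T : ℝ) (u : (Fin d → ℝ) → ℝ → ℝ) : ℝ :=
  Real.sqrt (∫ t in Set.Ioc (0 : ℝ) T, ∫ x in unitCube d, (u x t) ^ 2)

/-- Supremum norm over space. -/
def supT {d : ℕ} (F : (Fin d → ℝ) → ℝ) : ℝ := ⨆ x, |F x|

/-- Supremum norm over `𝕋^d × [0,T]`. -/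
def supQ {d : ℕ} (T : ℝ) (u : (Fin d → ℝ) → ℝ → ℝ) : ℝ :=
  ⨆ x, ⨆ t ∈ Set.Icc (0 : ℝ) T, |u x t|

/-- Squared Sobolev `H^β`-norm on the torus:  `∑_{|j| ≤ β} ‖∂^j F‖²_{L²(𝕋^d)}`. -/
def hSobSq {d : ℕ} (β : ℕ) (F : (Fin d → ℝ) → ℝ) : ℝ :=
  ∑ j ∈ Finset.univ.filter (fun j : Fin d → Fin (β + 1) => (∑ i, (j i : ℕ)) ≤ β),
    ∫ x in unitCube d, (mder (fun i => (j i : ℕ)) F x) ^ 2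

/-- Sobolev `H^β`-norm on the torus. -/
def hSob {d : ℕ} (β : ℕ) (F : (Fin d → ℝ) → ℝ) : ℝ := Real.sqrt (hSobSq β F)

/-- Squared parabolic Sobolev `H^{2,1}(Q)`-norm. -/
def h21Sq {d : ℕ} (T : ℝ) (u : (Fin d → ℝ) → ℝ → ℝ) : ℝ :=
  (∫ t in Set.Ioc (0 : ℝ) T,
      ∑ j ∈ Finset.univ.filter (fun j : Fin d → Fin 3 => (∑ i, (j i : ℕ)) ≤ 2),
        ∫ x in unitCube d, (mder (fun i => (j i : ℕ)) (fun y => u y t) x) ^ 2)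
    + ∫ x in unitCube d, ∫ t in Set.Ioc (0 : ℝ) T, ((u x t) ^ 2 + (deriv (u x) t) ^ 2)

/-- Parabolic Sobolev `H^{2,1}(Q)`-norm. -/
def h21 {d : ℕ} (T : ℝ) (u : (Fin d → ℝ) → ℝ → ℝ) : ℝ := Real.sqrt (h21Sq T u)

/-- Smoothness of a function of space and time. -/
def SmoothQ {d : ℕ} (u : (Fin d → ℝ) → ℝ → ℝ) : Prop :=
  ContDiff ℝ (⊤ : ℕ∞) fun p : (Fin d → ℝ) × ℝ => u p.1 p.2

/-- A smooth classical solution of the heat equation with absorption `f`,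
diffusivity `θ` and initial value `u0`. -/
def HeatSol {d : ℕ} (T θ : ℝ) (f u0 : (Fin d → ℝ) → ℝ) (u : (Fin d → ℝ) → ℝ → ℝ) : Prop :=
  SmoothQ u ∧ ZPerSpace u ∧
    (∀ (x : Fin d → ℝ), ∀ t ∈ Set.Ioc (0 : ℝ) T,
      deriv (u x) t = θ / 2 * lap (fun y => u y t) x - f x * u x t) ∧
    ∀ x, u x 0 = u0 x

/-- A smooth solution of the inhomogeneous problem with forcing `g` and
zero initial value (`v = 𝓛_{θ,f}⁻¹ g`). -/
def InhomSol {d : ℕ} (T θ : ℝ) (f : (Fin d → ℝ) → ℝ) (g v : (Fin d → ℝ) → ℝ → ℝ) : Prop :=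
  SmoothQ v ∧ ZPerSpace v ∧
    (∀ (x : Fin d → ℝ), ∀ t ∈ Set.Ioc (0 : ℝ) T,
      deriv (v x) t = θ / 2 * lap (fun y => v y t) x - f x * v x t + g x t) ∧
    ∀ x, v x 0 = 0

/-- A link function: a smooth function `Φ : ℝ → (fmin, ∞)` with strictly positive
derivative and all derivatives bounded. -/
structure LinkFun where
  toFun : ℝ → ℝ
  fmin : ℝ
  fmin_pos : 0 < fmin
  smooth : ContDiff ℝ (⊤ : ℕ∞) toFun
  gt_fmin : ∀ x, fmin < toFun x
  deriv_pos : ∀ x, 0 < deriv toFun x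
  derivs_bdd : ∀ n : ℕ, 1 ≤ n → ∃ C, ∀ x, |iteratedDeriv n toFun x| ≤ C

/-- The linearized solution `I_{θ,F} h` in direction `h`, associated with a solution `u`. -/
def LinSol {d : ℕ} (T θ : ℝ) (Φ : LinkFun) (F h : (Fin d → ℝ) → ℝ)
    (u z : (Fin d → ℝ) → ℝ → ℝ) : Prop :=
  SmoothQ z ∧ ZPerSpace z ∧
    (∀ (x : Fin d → ℝ), ∀ t ∈ Set.Ioc (0 : ℝ) T,
      deriv (z x) t = θ / 2 * lap (fun y => z y t) x - Φ.toFun (F x) * z x t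
        + h x * deriv Φ.toFun (F x) * u x t) ∧
    ∀ x, z x 0 = 0

/-- The `θ`-derivative solution `K̇_θ F`, associated with a solution `u`. -/
def ThetaDerivSol {d : ℕ} (T θ : ℝ) (Φ : LinkFun) (F : (Fin d → ℝ) → ℝ)
    (u w : (Fin d → ℝ) → ℝ → ℝ) : Prop :=
  SmoothQ w ∧ ZPerSpace w ∧
    (∀ (x : Fin d → ℝ), ∀ t ∈ Set.Ioc (0 : ℝ) T,
      deriv (w x) t = θ / 2 * lap (fun y => w y t) x - Φ.toFun (F x) * w x t
        + 1 / 2 * lap (fun y => u y t) x) ∧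
    ∀ x, w x 0 = 0

/-- Dual Sobolev norm `‖G‖_{(H²)*}` on the torus. -/
def h2dual {d : ℕ} (G : (Fin d → ℝ) → ℝ) : ℝ :=
  sSup {r : ℝ | ∃ g : (Fin d → ℝ) → ℝ, ContDiff ℝ (⊤ : ℕ∞) g ∧ ZPer g ∧ hSob 2 g ≤ 1 ∧
    r = |∫ x in unitCube d, G x * g x|}

end

/-- Smooth `ℤ^d`-periodic functions on `ℝ^d`. -/
structure SmoothPer {d : ℕ} (v : (Fin d → ℝ) → ℝ) : Prop where
  smooth : ContDiff ℝ (⊤ : ℕ∞) v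
  per : ZPer v

section PartialDerivatives

variable {d : ℕ}

theorem hasDerivAt_pder {v : (Fin d → ℝ) → ℝ} {x : Fin d → ℝ} (hv : DifferentiableAt ℝ v x)
    (i : Fin d) : HasDerivAt (fun s => v (Function.update x i s)) (pder i v x) (x i) := by
  have h1 : HasDerivAt (fun s => Function.update x i s) (Pi.single i (1 : ℝ)) (x i) :=
    hasDerivAt_update x i (x i)
  have h2 : HasFDerivAt v (fderiv ℝ v x) (Function.update x i (x i)) := by
    simpa using hv.hasFDerivAt
  have h3 := h2.comp_hasDerivAt (x i) h1
  exact h3.differentiableAt.hasDerivAt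

theorem pder_eq_fderiv {v : (Fin d → ℝ) → ℝ} {x : Fin d → ℝ} (hv : DifferentiableAt ℝ v x)
    (i : Fin d) : pder i v x = fderiv ℝ v x (Pi.single i 1) := by
  have h1 : HasDerivAt (fun s => Function.update x i s) (Pi.single i (1 : ℝ)) (x i) :=
    hasDerivAt_update x i (x i)
  have h2 : HasFDerivAt v (fderiv ℝ v x) (Function.update x i (x i)) := by
    simpa using hv.hasFDerivAt
  exact (h2.comp_hasDerivAt (x i) h1).deriv

theorem ContDiff.differentiable_of_top {E F : Type*} [NormedAddCommGroup E] [NormedSpace ℝ E]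
    [NormedAddCommGroup F] [NormedSpace ℝ F] {v : E → F} (hv : ContDiff ℝ (⊤ : ℕ∞) v) :
    Differentiable ℝ v :=
  hv.differentiable (by simp)

theorem ContDiff.fderiv_apply_const {E F : Type*} [NormedAddCommGroup E] [NormedSpace ℝ E]
    [NormedAddCommGroup F] [NormedSpace ℝ F] {v : E → F} (hv : ContDiff ℝ (⊤ : ℕ∞) v) (a : E) :
    ContDiff ℝ (⊤ : ℕ∞) fun x => fderiv ℝ v x a :=
  (hv.fderiv_right (m := (⊤ : ℕ∞)) (by simp)).clm_apply contDiff_const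

theorem fderiv_fderiv_comm {E F : Type*} [NormedAddCommGroup E] [NormedSpace ℝ E]
    [NormedAddCommGroup F] [NormedSpace ℝ F] {v : E → F} (hv : ContDiff ℝ (⊤ : ℕ∞) v)
    (a b x : E) :
    fderiv ℝ (fun y => fderiv ℝ v y a) x b = fderiv ℝ (fun y => fderiv ℝ v y b) x a := by
  have hd : DifferentiableAt ℝ (fderiv ℝ v) x :=
    ((hv.fderiv_right (m := (⊤ : ℕ∞)) (by simp)).differentiable (by simp)) x
  have hs : IsSymmSndFDerivAt ℝ v x :=
    hv.contDiffAt.isSymmSndFDerivAt (by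
      rw [minSmoothness_of_isRCLikeNormedField]
      exact WithTop.coe_le_coe.2 le_top)
  have key (c : E) : fderiv ℝ (fun y => fderiv ℝ v y c) x = (fderiv ℝ (fderiv ℝ v) x).flip c := by
    rw [fderiv_clm_apply hd (differentiableAt_const c)]
    simp
  rw [key, key]
  exact hs b a

theorem pder_funext {v : (Fin d → ℝ) → ℝ} (hv : ContDiff ℝ (⊤ : ℕ∞) v) (i : Fin d) :
    pder i v = fun x => fderiv ℝ v x (Pi.single i 1) :=
  funext fun x => pder_eq_fderiv (hv.differentiable_of_top x) i

theorem contDiff_pder {v : (Fin d → ℝ) → ℝ} (hv : ContDiff ℝ (⊤ : ℕ∞) v) (i : Fin d) :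
    ContDiff ℝ (⊤ : ℕ∞) (pder i v) := by
  rw [pder_funext hv]
  exact hv.fderiv_apply_const _

theorem pder_comm {v : (Fin d → ℝ) → ℝ} (hv : ContDiff ℝ (⊤ : ℕ∞) v) (i j : Fin d) :
    pder i (pder j v) = pder j (pder i v) := by
  rw [pder_funext (contDiff_pder hv j), pder_funext (contDiff_pder hv i), pder_funext hv,
    pder_funext hv]
  exact funext fun x => fderiv_fderiv_comm hv _ _ _

theorem zper_pder {v : (Fin d → ℝ) → ℝ} (hv : ZPer v) (i : Fin d) : ZPer (pder i v) := by
  intro x k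
  have h : (fun s => v (Function.update (fun j => x j + (k j : ℝ)) i s))
      = fun s => v (Function.update x i (s - k i)) := by
    funext s
    rw [← hv (Function.update x i (s - k i)) k]
    congr 1
    funext j
    by_cases hj : j = i
    · subst hj; simp
    · simp [hj]
  simp only [pder, h]
  rw [deriv_comp_sub_const (f := fun s => v (Function.update x i s))]
  simp

theorem SmoothPer.pder {v : (Fin d → ℝ) → ℝ} (hv : SmoothPer v) (i : Fin d) :
    SmoothPer (pder i v) :=
  ⟨contDiff_pder hv.smooth i, zper_pder hv.per i⟩

theorem SmoothPer.add {v w : (Fin d → ℝ) → ℝ} (hv : SmoothPer v) (hw : SmoothPer w) :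
    SmoothPer fun x => v x + w x :=
  ⟨hv.smooth.add hw.smooth, fun x k => by rw [hv.per x k, hw.per x k]⟩

theorem SmoothPer.sub {v w : (Fin d → ℝ) → ℝ} (hv : SmoothPer v) (hw : SmoothPer w) :
    SmoothPer fun x => v x - w x :=
  ⟨hv.smooth.sub hw.smooth, fun x k => by rw [hv.per x k, hw.per x k]⟩

theorem SmoothPer.mul {v w : (Fin d → ℝ) → ℝ} (hv : SmoothPer v) (hw : SmoothPer w) :
    SmoothPer fun x => v x * w x :=
  ⟨hv.smooth.mul hw.smooth, fun x k => by rw [hv.per x k, hw.per x k]⟩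

theorem SmoothPer.const_mul {v : (Fin d → ℝ) → ℝ} (hv : SmoothPer v) (c : ℝ) :
    SmoothPer fun x => c * v x :=
  ⟨contDiff_const.mul hv.smooth, fun x k => by rw [hv.per x k]⟩

theorem SmoothPer.comp {v : (Fin d → ℝ) → ℝ} (hv : SmoothPer v) {Ψ : ℝ → ℝ}
    (hΨ : ContDiff ℝ (⊤ : ℕ∞) Ψ) : SmoothPer fun x => Ψ (v x) :=
  ⟨hΨ.comp hv.smooth, fun x k => by rw [hv.per x k]⟩

theorem pder_add {v w : (Fin d → ℝ) → ℝ} (hv : ContDiff ℝ (⊤ : ℕ∞) v)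
    (hw : ContDiff ℝ (⊤ : ℕ∞) w) (i : Fin d) :
    pder i (fun x => v x + w x) = fun x => pder i v x + pder i w x := by
  funext x
  have := ((hasDerivAt_pder (hv.differentiable_of_top x) i).add
    (hasDerivAt_pder (hw.differentiable_of_top x) i))
  exact this.deriv

theorem pder_sub {v w : (Fin d → ℝ) → ℝ} (hv : ContDiff ℝ (⊤ : ℕ∞) v)
    (hw : ContDiff ℝ (⊤ : ℕ∞) w) (i : Fin d) :
    pder i (fun x => v x - w x) = fun x => pder i v x - pder i w x := by
  funext x
  have := ((hasDerivAt_pder (hv.differentiable_of_top x) i).sub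
    (hasDerivAt_pder (hw.differentiable_of_top x) i))
  exact this.deriv

theorem pder_mul {v w : (Fin d → ℝ) → ℝ} (hv : ContDiff ℝ (⊤ : ℕ∞) v)
    (hw : ContDiff ℝ (⊤ : ℕ∞) w) (i : Fin d) :
    pder i (fun x => v x * w x) = fun x => pder i v x * w x + v x * pder i w x := by
  funext x
  have := ((hasDerivAt_pder (hv.differentiable_of_top x) i).mul
    (hasDerivAt_pder (hw.differentiable_of_top x) i))
  have h := this.deriv
  simp only [Function.update_eq_self] at h
  exact h

theorem pder_const_mul {v : (Fin d → ℝ) → ℝ} (hv : ContDiff ℝ (⊤ : ℕ∞) v) (c : ℝ)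
    (i : Fin d) : pder i (fun x => c * v x) = fun x => c * pder i v x := by
  funext x
  exact ((hasDerivAt_pder (hv.differentiable_of_top x) i).const_mul c).deriv

theorem pder_comp {v : (Fin d → ℝ) → ℝ} (hv : ContDiff ℝ (⊤ : ℕ∞) v) {Ψ : ℝ → ℝ}
    (hΨ : ContDiff ℝ (⊤ : ℕ∞) Ψ) (i : Fin d) :
    pder i (fun x => Ψ (v x)) = fun x => deriv Ψ (v x) * pder i v x := by
  funext x
  have h1 : HasDerivAt Ψ (deriv Ψ (v x)) (v (Function.update x i (x i))) := by
    simpa using (hΨ.differentiable_of_top (v x)).hasDerivAt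
  exact (h1.comp (x i) (hasDerivAt_pder (hv.differentiable_of_top x) i)).deriv

theorem contDiff_deriv_top {Ψ : ℝ → ℝ} (hΨ : ContDiff ℝ (⊤ : ℕ∞) Ψ) :
    ContDiff ℝ (⊤ : ℕ∞) (deriv Ψ) :=
  (contDiff_infty_iff_deriv.1 hΨ).2

end PartialDerivatives

section MultiIndex

variable {d : ℕ}

/-- Successive partial derivatives along a list of coordinate directions. -/
noncomputable def listDer (l : List (Fin d)) (v : (Fin d → ℝ) → ℝ) : (Fin d → ℝ) → ℝ :=
  l.foldr pder v

theorem SmoothPer.listDer {v : (Fin d → ℝ) → ℝ} (hv : SmoothPer v) (l : List (Fin d)) :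
    SmoothPer (listDer l v) := by
  induction l with
  | nil => exact hv
  | cons i l ih => exact ih.pder i

theorem mder_eq_listDer (j : Fin d → ℕ) (v : (Fin d → ℝ) → ℝ) :
    mder j v = listDer ((List.finRange d).flatMap fun i => List.replicate (j i) i) v := by
  have hrep (n : ℕ) (i : Fin d) (w : (Fin d → ℝ) → ℝ) :
      (pder i)^[n] w = (List.replicate n i).foldr pder w := by
    induction n with
    | zero => rfl
    | succ n ih => rw [Function.iterate_succ_apply', ih, List.replicate_succ, List.foldr_cons]
  unfold mder listDer
  induction List.finRange d with
  | nil => rfl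
  | cons i l ih => rw [List.foldr_cons, ih, List.flatMap_cons, List.foldr_append, hrep]

theorem listDer_perm {v : (Fin d → ℝ) → ℝ} (hv : SmoothPer v) {l l' : List (Fin d)}
    (h : l.Perm l') : listDer l v = listDer l' v := by
  induction h with
  | nil => rfl
  | cons i _ ih => exact congrArg (pder i) ih
  | swap i j l => exact pder_comm (hv.listDer l).smooth _ _
  | trans _ _ ih₁ ih₂ => exact ih₁.trans ih₂

theorem listDer_eq_mder {v : (Fin d → ℝ) → ℝ} (hv : SmoothPer v) (l : List (Fin d)) :
    listDer l v = mder (fun i => l.count i) v := by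
  rw [mder_eq_listDer]
  refine listDer_perm hv (List.perm_iff_count.2 fun i => ?_)
  rw [List.count_flatMap]
  have : (List.map (List.count i ∘ fun i => List.replicate (l.count i) i) (List.finRange d))
      = List.map (fun j => if j = i then l.count i else 0) (List.finRange d) := by
    refine List.map_congr_left fun j _ => ?_
    by_cases hj : j = i
    · subst hj; simp
    · simp [List.count_replicate, hj]
  rw [this, ← List.ofFn_eq_map, List.sum_ofFn]
  simp

theorem length_mder_list (j : Fin d → ℕ) :
    ((List.finRange d).flatMap fun i => List.replicate (j i) i).length = ∑ i, j i := by
  rw [List.length_flatMap]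
  simp only [List.length_replicate]
  rw [← List.ofFn_eq_map, List.sum_ofFn]

theorem integral_listDer_sq_le {v : (Fin d → ℝ) → ℝ} (hv : SmoothPer v) {β : ℕ}
    {l : List (Fin d)} (hl : l.length ≤ β) :
    ∫ x in unitCube d, (listDer l v x) ^ 2 ≤ hSobSq β v := by
  have hsum : ∑ i, l.count i = l.length := by
    simpa using Multiset.sum_count_eq_card (s := Finset.univ) (m := (l : Multiset (Fin d)))
      (fun _ _ => Finset.mem_univ _)
  have hc (i : Fin d) : l.count i < β + 1 :=
    Nat.lt_succ_of_le (List.count_le_length.trans hl)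
  rw [listDer_eq_mder hv]
  unfold hSobSq
  refine Finset.single_le_sum
    (f := fun j : Fin d → Fin (β + 1) => ∫ x in unitCube d, (mder (fun i => (j i : ℕ)) v x) ^ 2)
    (fun j _ => integral_nonneg fun x => sq_nonneg _) (a := fun i => ⟨l.count i, hc i⟩) ?_
  simpa [hsum] using hl

/-- There are at most `(β + 1) ^ d` multi-indices in the `H^β` norm. -/
theorem hSobSq_le_of_listDer {v : (Fin d → ℝ) → ℝ} {β : ℕ} {B : ℝ}
    (hB : ∀ l : List (Fin d), l.length ≤ β → ∫ x in unitCube d, (listDer l v x) ^ 2 ≤ B) :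
    hSobSq β v ≤ ((β + 1 : ℕ) : ℝ) ^ d * B := by
  have hB0 : 0 ≤ B := (integral_nonneg fun x => sq_nonneg _).trans (hB [] (Nat.zero_le _))
  unfold hSobSq
  refine (Finset.sum_le_card_nsmul _ _ B fun j hj => ?_).trans ?_
  · rw [mder_eq_listDer]
    refine hB _ ?_
    rw [length_mder_list]
    simpa using hj
  · rw [nsmul_eq_mul]
    refine mul_le_mul_of_nonneg_right ?_ hB0
    have := Finset.card_filter_le (Finset.univ : Finset (Fin d → Fin (β + 1)))
      (fun j => ∑ i, (j i : ℕ) ≤ β)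
    have h2 : (Finset.univ : Finset (Fin d → Fin (β + 1))).card = (β + 1) ^ d := by simp
    rw [h2] at this
    exact_mod_cast this

end MultiIndex

section CubeIntegrals

variable {d : ℕ} {E : Type*} [NormedAddCommGroup E]

theorem isCompact_unitCube (d : ℕ) : IsCompact (unitCube d) := isCompact_Icc

theorem Continuous.integrableOn_unitCube {g : (Fin d → ℝ) → E} (hg : Continuous g) :
    IntegrableOn g (unitCube d) :=
  hg.continuousOn.integrableOn_compact (isCompact_unitCube d)

variable [NormedSpace ℝ E]

theorem volume_unitCube (d : ℕ) : volume (unitCube d) = 1 := by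
  rw [unitCube, Real.volume_Icc_pi]
  simp

theorem integral_unitCube_mono {f g : (Fin d → ℝ) → ℝ} (hf : Continuous f) (hg : Continuous g)
    (h : ∀ x, f x ≤ g x) : ∫ x in unitCube d, f x ≤ ∫ x in unitCube d, g x :=
  integral_mono hf.integrableOn_unitCube hg.integrableOn_unitCube h

theorem integral_unitCube_const (c : ℝ) : ∫ _ in unitCube d, c = c := by
  simp [Measure.real, volume_unitCube]

/-- Differentiation under the integral over the unit cube. -/
theorem hasDerivAt_integral_unitCube {g : (Fin d → ℝ) → ℝ → E}
    (hg : ContDiff ℝ 1 fun p : (Fin d → ℝ) × ℝ => g p.1 p.2) (t : ℝ) :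
    HasDerivAt (fun s => ∫ x in unitCube d, g x s) (∫ x in unitCube d, deriv (g x) t) t := by
  have hdiff (x : Fin d → ℝ) (s : ℝ) : HasDerivAt (g x)
      (fderiv ℝ (fun p : (Fin d → ℝ) × ℝ => g p.1 p.2) (x, s) (0, 1)) s := by
    have h1 : HasDerivAt (fun s : ℝ => (x, s)) ((0 : Fin d → ℝ), (1 : ℝ)) s :=
      (hasDerivAt_const s x).prodMk (hasDerivAt_id s)
    exact ((hg.differentiable one_ne_zero (x, s)).hasFDerivAt).comp_hasDerivAt s h1
  have hcont : Continuous fun p : (Fin d → ℝ) × ℝ => deriv (g p.1) p.2 := by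
    have : (fun p : (Fin d → ℝ) × ℝ => deriv (g p.1) p.2) =
        fun p => fderiv ℝ (fun p : (Fin d → ℝ) × ℝ => g p.1 p.2) p (0, 1) :=
      funext fun p => (hdiff p.1 p.2).deriv
    rw [this]
    exact (hg.continuous_fderiv one_ne_zero).clm_apply continuous_const
  obtain ⟨B, hB⟩ := ((isCompact_unitCube d).prod (isCompact_Icc (a := t - 1) (b := t + 1)))
    |>.exists_bound_of_continuousOn hcont.continuousOn
  refine (hasDerivAt_integral_of_dominated_loc_of_deriv_le (s := Set.Icc (t - 1) (t + 1))
    (bound := fun _ => B) (F := fun s x => g x s) (F' := fun s x => deriv (g x) s)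
    (Icc_mem_nhds (by linarith) (by linarith)) ?_ ?_ ?_ ?_ ?_ ?_).2
  · refine Eventually.of_forall fun s => ?_
    exact (hg.continuous.comp (Continuous.prodMk_left s)).integrableOn_unitCube.1
  · exact (hg.continuous.comp (Continuous.prodMk_left t)).integrableOn_unitCube
  · exact (hcont.comp (Continuous.prodMk_left t)).integrableOn_unitCube.1
  · refine (ae_restrict_iff' (isCompact_unitCube d).measurableSet).2 (Eventually.of_forall ?_)
    intro x hx s hs
    exact hB (x, s) ⟨hx, hs⟩
  · exact continuous_const.integrableOn_unitCube
  · exact Eventually.of_forall fun x s _ => (hdiff x s).differentiableAt.hasDerivAt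

theorem continuous_integral_unitCube {g : (Fin d → ℝ) → ℝ → ℝ}
    (hg : Continuous fun p : (Fin d → ℝ) × ℝ => g p.1 p.2) :
    Continuous fun s => ∫ x in unitCube d, g x s := by
  refine continuous_parametric_integral_of_continuous (f := fun s x => g x s) ?_
    (isCompact_unitCube d)
  exact hg.comp continuous_swap

/-- A `ℤ^d`-periodic function factors through the torus. -/
theorem exists_torus_lift {α : Type*} {g : (Fin d → ℝ) → α}
    (hg : ∀ (x : Fin d → ℝ) (k : Fin d → ℤ), g (fun i => x i + (k i : ℝ)) = g x) :
    ∃ G : UnitAddTorus (Fin d) → α, ∀ x : Fin d → ℝ, G (fun i => (x i : UnitAddCircle)) = g x := by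
  refine ⟨fun y => g fun i => (AddCircle.equivIoc 1 0 (y i) : ℝ), fun x => ?_⟩
  have h (i : Fin d) : ∃ n : ℤ, (AddCircle.equivIoc 1 0 (x i : UnitAddCircle) : ℝ) = x i + n := by
    have h1 := AddCircle.coe_equivIoc (p := (1 : ℝ)) (a := 0) (y := (x i : UnitAddCircle))
    obtain ⟨n, hn⟩ := AddSubgroup.mem_zmultiples_iff.1 (QuotientAddGroup.eq_iff_sub_mem.1 h1)
    refine ⟨n, ?_⟩
    rw [zsmul_eq_mul, mul_one] at hn
    rw [hn]
    ring
  choose n hn using h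
  simp only [hn]
  exact hg x n

theorem continuous_torus_lift {F : Type*} [TopologicalSpace F] {G : UnitAddTorus (Fin d) → F}
    (h : Continuous fun x : Fin d → ℝ => G fun i => (x i : UnitAddCircle)) : Continuous G := by
  have hq : IsOpenQuotientMap
      (Pi.map fun (_ : Fin d) (s : ℝ) => (s : UnitAddCircle)) :=
    IsOpenQuotientMap.piMap fun _ => QuotientAddGroup.isOpenQuotientMap_mk
  exact hq.isQuotientMap.continuous_iff.2 h

theorem unitCube_ae_eq_translate (a : Fin d → ℝ) :
    {x : Fin d → ℝ | ∀ i, x i ∈ Set.Ioc (a i) (a i + 1)} =ᵐ[volume] Set.Icc a (a + 1) := by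
  have := Measure.univ_pi_Ioc_ae_eq_Icc (μ := fun _ : Fin d => (volume : Measure ℝ)) (f := a)
    (g := a + 1)
  have hset : {x : Fin d → ℝ | ∀ i, x i ∈ Set.Ioc (a i) (a i + 1)}
      = Set.univ.pi fun i => Set.Ioc (a i) ((a + 1) i) := by
    ext x
    simp
  rw [hset]
  exact this

theorem integral_unitCube_translate {g : (Fin d → ℝ) → E}
    (hg : ∀ (x : Fin d → ℝ) (k : Fin d → ℤ), g (fun i => x i + (k i : ℝ)) = g x)
    (a : Fin d → ℝ) : ∫ x in unitCube d, g (x + a) = ∫ x in unitCube d, g x := by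
  obtain ⟨G, hG⟩ := exists_torus_lift hg
  have h0 := (UnitAddTorus.integral_preimage G a).symm.trans (UnitAddTorus.integral_preimage G 0)
  simp only [hG] at h0
  rw [setIntegral_congr_set (unitCube_ae_eq_translate a),
    setIntegral_congr_set (unitCube_ae_eq_translate 0), zero_add] at h0
  rw [unitCube, ← h0]
  have hmp : MeasurePreserving (fun x : Fin d → ℝ => x + a) volume volume :=
    measurePreserving_add_right volume a
  rw [← hmp.setIntegral_preimage_emb (measurableEmbedding_addRight a) g (Set.Icc a (a + 1))]
  congr 2
  ext x
  simp [Set.mem_Icc, Pi.le_def, add_comm]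

theorem integral_unitCube_fderiv [CompleteSpace E] {g : (Fin d → ℝ) → E}
    (hs : ContDiff ℝ (⊤ : ℕ∞) g)
    (hg : ∀ (x : Fin d → ℝ) (k : Fin d → ℤ), g (fun i => x i + (k i : ℝ)) = g x)
    (a : Fin d → ℝ) : ∫ x in unitCube d, fderiv ℝ g x a = 0 := by
  have hsm : ContDiff ℝ 1 fun p : (Fin d → ℝ) × ℝ => g (p.1 + p.2 • a) :=
    (hs.of_le (by exact_mod_cast le_top)).comp
      (contDiff_fst.add (contDiff_snd.smul contDiff_const))
  have h1 := hasDerivAt_integral_unitCube (g := fun x s => g (x + s • a)) hsm 0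
  have hd (x : Fin d → ℝ) : deriv (fun s : ℝ => g (x + s • a)) 0 = fderiv ℝ g x a := by
    have hl : HasDerivAt (fun s : ℝ => x + s • a) a 0 := by
      simpa using ((hasDerivAt_id (0 : ℝ)).smul_const a).const_add x
    have hf : HasFDerivAt g (fderiv ℝ g x) (x + (0 : ℝ) • a) := by
      simpa using (hs.differentiable_of_top x).hasFDerivAt
    exact (hf.comp_hasDerivAt (0 : ℝ) hl).deriv
  simp only [hd, fun s : ℝ => integral_unitCube_translate hg (s • a)] at h1
  exact h1.unique (hasDerivAt_const _ _)

end CubeIntegrals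

section FourierModes

variable {d : ℕ}

/-- The character `x ↦ exp (2πi k·x)`. -/
noncomputable def expMode (k : Fin d → ℤ) (x : Fin d → ℝ) : ℂ :=
  Complex.exp (2 * π * Complex.I * ∑ i, (k i : ℂ) * (x i : ℂ))

/-- Fourier coefficients of a function on the torus. -/
noncomputable def fourCoeff (v : (Fin d → ℝ) → ℝ) (k : Fin d → ℤ) : ℂ :=
  ∫ x in unitCube d, expMode (-k) x * (v x : ℂ)

theorem mFourier_coe (k : Fin d → ℤ) (x : Fin d → ℝ) :
    UnitAddTorus.mFourier k (fun i => (x i : UnitAddCircle)) = expMode k x := by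
  simp only [UnitAddTorus.mFourier, ContinuousMap.coe_mk, expMode, fourier_coe_apply]
  rw [← Complex.exp_sum, Finset.mul_sum]
  congr 1
  refine Finset.sum_congr rfl fun i _ => ?_
  push_cast
  ring

theorem norm_expMode (k : Fin d → ℤ) (x : Fin d → ℝ) : ‖expMode k x‖ = 1 := by
  have : 2 * π * Complex.I * ∑ i, (k i : ℂ) * (x i : ℂ)
      = ((2 * π * ∑ i, (k i : ℝ) * x i : ℝ) : ℂ) * Complex.I := by
    push_cast
    ring
  rw [expMode, this, Complex.norm_exp_ofReal_mul_I]

theorem conj_expMode (k : Fin d → ℤ) (x : Fin d → ℝ) :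
    (starRingEnd ℂ) (expMode k x) = expMode (-k) x := by
  rw [← mFourier_coe, ← mFourier_coe, UnitAddTorus.mFourier_neg]

theorem expMode_per (k : Fin d → ℤ) (x : Fin d → ℝ) (n : Fin d → ℤ) :
    expMode k (fun i => x i + (n i : ℝ)) = expMode k x := by
  rw [← mFourier_coe, ← mFourier_coe]
  congr 1
  funext i
  rw [AddCircle.coe_add]
  have : ((n i : ℝ) : UnitAddCircle) = 0 :=
    (AddCircle.coe_eq_zero_iff 1).2 ⟨n i, by simp⟩
  rw [this, add_zero]

theorem contDiff_expMode (k : Fin d → ℤ) : ContDiff ℝ (⊤ : ℕ∞) (expMode k) := by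
  unfold expMode
  refine Complex.contDiff_exp.comp (contDiff_const.mul (ContDiff.sum fun i _ => ?_))
  exact contDiff_const.mul (Complex.ofRealCLM.contDiff.comp (contDiff_apply ℝ ℝ i))

theorem hasDerivAt_expMode_update (k : Fin d → ℤ) (x : Fin d → ℝ) (i : Fin d) (s : ℝ) :
    HasDerivAt (fun s : ℝ => expMode k (Function.update x i s))
      (2 * π * Complex.I * k i * expMode k (Function.update x i s)) s := by
  have h1 : HasDerivAt (fun s : ℝ => ∑ j, (k j : ℂ) * ((Function.update x i s j : ℝ) : ℂ))
      (∑ j, (k j : ℂ) * ((Pi.single i (1 : ℝ) : Fin d → ℝ) j : ℂ)) s := by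
    refine HasDerivAt.fun_sum fun j _ => HasDerivAt.const_mul _ ?_
    exact (hasDerivAt_pi.1 (hasDerivAt_update x i s) j).ofReal_comp
  have h2 : ∑ j, (k j : ℂ) * ((Pi.single i (1 : ℝ) : Fin d → ℝ) j : ℂ) = k i := by
    rw [Finset.sum_eq_single i]
    · simp
    · intro j _ hj
      simp [hj]
    · simp
  rw [h2] at h1
  have h3 := (h1.const_mul (2 * π * Complex.I : ℂ)).cexp
  refine h3.congr_deriv ?_
  rw [expMode]
  ring

theorem fderiv_expMode (k : Fin d → ℤ) (x : Fin d → ℝ) (i : Fin d) :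
    fderiv ℝ (expMode k) x (Pi.single i 1) = 2 * π * Complex.I * k i * expMode k x := by
  have h1 : HasDerivAt (fun s => Function.update x i s) (Pi.single i (1 : ℝ)) (x i) :=
    hasDerivAt_update x i (x i)
  have h2 : HasFDerivAt (expMode k) (fderiv ℝ (expMode k) x) (Function.update x i (x i)) := by
    simpa using ((contDiff_expMode k).differentiable_of_top x).hasFDerivAt
  have h3 := hasDerivAt_expMode_update k x i (x i)
  rw [Function.update_eq_self] at h3
  exact (h2.comp_hasDerivAt (x i) h1).unique h3

theorem continuous_fourCoeff_integrand {v : (Fin d → ℝ) → ℝ} (hv : Continuous v)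
    (k : Fin d → ℤ) : Continuous fun x => expMode k x * (v x : ℂ) :=
  (contDiff_expMode k).continuous.mul (Complex.continuous_ofReal.comp hv)

theorem fourCoeff_pder {v : (Fin d → ℝ) → ℝ} (hv : SmoothPer v) (i : Fin d) (k : Fin d → ℤ) :
    fourCoeff (pder i v) k = 2 * π * Complex.I * k i * fourCoeff v k := by
  have hvc : ContDiff ℝ (⊤ : ℕ∞) fun x => (v x : ℂ) := Complex.ofRealCLM.contDiff.comp hv.smooth
  have h := integral_unitCube_fderiv (g := fun x => expMode (-k) x * (v x : ℂ))
    ((contDiff_expMode (-k)).mul hvc)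
    (fun x n => by rw [expMode_per, hv.per x n]) (Pi.single i 1)
  have hD (x : Fin d → ℝ) :
      fderiv ℝ (fun x => expMode (-k) x * (v x : ℂ)) x (Pi.single i 1)
        = expMode (-k) x * (pder i v x : ℂ)
          - 2 * π * Complex.I * k i * (expMode (-k) x * (v x : ℂ)) := by
    have h1 : HasFDerivAt (fun x => (v x : ℂ)) (Complex.ofRealCLM.comp (fderiv ℝ v x)) x :=
      Complex.ofRealCLM.hasFDerivAt.comp x (hv.smooth.differentiable_of_top x).hasFDerivAt
    have h2 : HasFDerivAt (fun x => expMode (-k) x * (v x : ℂ)) _ x :=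
      ((contDiff_expMode (-k)).differentiable_of_top x).hasFDerivAt.mul h1
    rw [h2.fderiv]
    simp only [_root_.add_apply, _root_.smul_apply, fderiv_expMode,
      pder_eq_fderiv (hv.smooth.differentiable_of_top x)]
    simp
    ring
  simp only [hD] at h
  rw [integral_sub
    (f := fun x => expMode (-k) x * (pder i v x : ℂ))
    (g := fun x => 2 * π * Complex.I * k i * (expMode (-k) x * (v x : ℂ)))
    (continuous_fourCoeff_integrand (hv.pder i).smooth.continuous (-k)).integrableOn_unitCube
    ((continuous_fourCoeff_integrand hv.smooth.continuous
      (-k)).const_smul (2 * π * Complex.I * k i : ℂ)).integrableOn_unitCube,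
    integral_const_mul] at h
  exact sub_eq_zero.1 h

theorem exists_continuousMap_torus_lift {v : (Fin d → ℝ) → ℝ} (hv : SmoothPer v) :
    ∃ V : C(UnitAddTorus (Fin d), ℂ),
      (∀ x : Fin d → ℝ, V (fun i => (x i : UnitAddCircle)) = v x) ∧
      ∀ k, UnitAddTorus.mFourierCoeff V k = fourCoeff v k := by
  obtain ⟨V, hV⟩ := exists_torus_lift (g := fun x => (v x : ℂ))
    (fun x k => by rw [hv.per x k])
  have hc : Continuous V := continuous_torus_lift (by
    simp only [hV]
    exact Complex.continuous_ofReal.comp hv.smooth.continuous)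
  refine ⟨⟨V, hc⟩, hV, fun k => ?_⟩
  rw [UnitAddTorus.mFourierCoeff_eq_integral _ _ (0 : Fin d → ℝ),
    setIntegral_congr_set (unitCube_ae_eq_translate 0), zero_add]
  simp only [ContinuousMap.coe_mk, hV, mFourier_coe, smul_eq_mul]
  rfl

theorem hasSum_sq_fourCoeff {v : (Fin d → ℝ) → ℝ} (hv : SmoothPer v) :
    HasSum (fun k => ‖fourCoeff v k‖ ^ 2) (∫ x in unitCube d, (v x) ^ 2) := by
  obtain ⟨V, hV, hc⟩ := exists_continuousMap_torus_lift hv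
  let _ : MeasureSpace UnitAddCircle := ⟨AddCircle.haarAddCircle⟩
  have : IsProbabilityMeasure (volume : Measure UnitAddCircle) :=
    inferInstanceAs (IsProbabilityMeasure AddCircle.haarAddCircle)
  have h := UnitAddTorus.hasSum_sq_mFourierCoeff (ContinuousMap.toLp 2 volume ℂ V)
  simp only [UnitAddTorus.mFourierCoeff_toLp, hc] at h
  convert h using 1
  rw [integral_congr_ae (g := fun t => ‖V t‖ ^ 2)
    (by filter_upwards [ContinuousMap.coeFn_toLp (p := 2) (𝕜 := ℂ) volume V] with t ht; rw [ht]),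
    UnitAddTorus.integral_preimage (fun t => ‖V t‖ ^ 2) 0,
    setIntegral_congr_set (unitCube_ae_eq_translate 0), zero_add]
  simp only [hV, Complex.norm_real, Real.norm_eq_abs, sq_abs]
  rfl

theorem abs_le_tsum_norm_fourCoeff {v : (Fin d → ℝ) → ℝ} (hv : SmoothPer v)
    (hs : Summable fun k => ‖fourCoeff v k‖) (x : Fin d → ℝ) :
    |v x| ≤ ∑' k, ‖fourCoeff v k‖ := by
  obtain ⟨V, hV, hc⟩ := exists_continuousMap_torus_lift hv
  have hs' : Summable (UnitAddTorus.mFourierCoeff V) := by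
    rw [funext hc]
    exact hs.of_norm
  have h := UnitAddTorus.hasSum_mFourier_series_apply_of_summable hs'
    (fun i => (x i : UnitAddCircle))
  simp only [hV, hc, mFourier_coe, smul_eq_mul] at h
  have h2 : ‖(v x : ℂ)‖ ≤ ∑' k, ‖fourCoeff v k * expMode k x‖ := by
    rw [← h.tsum_eq]
    refine norm_tsum_le_tsum_norm ?_
    simpa [norm_expMode] using hs
  simpa [norm_expMode] using h2

/-- Real trigonometric polynomial with spectrum in `S`. -/
noncomputable def trigPoly (S : Finset (Fin d → ℤ)) (γ : (Fin d → ℤ) → ℂ) (x : Fin d → ℝ) : ℝ :=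
  ∑ k ∈ S, (γ k * expMode k x).re

theorem smoothPer_trigPoly (S : Finset (Fin d → ℤ)) (γ : (Fin d → ℤ) → ℂ) :
    SmoothPer (trigPoly S γ) := by
  constructor
  · refine ContDiff.sum fun k _ => ?_
    exact Complex.reCLM.contDiff.comp (contDiff_const.mul (contDiff_expMode k))
  · intro x n
    simp only [trigPoly, expMode_per]

theorem pder_trigPoly (S : Finset (Fin d → ℤ)) (γ : (Fin d → ℤ) → ℂ) (i : Fin d) :
    pder i (trigPoly S γ) = trigPoly S fun k => 2 * π * Complex.I * k i * γ k := by
  funext x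
  have h : HasDerivAt (fun s : ℝ => trigPoly S γ (Function.update x i s))
      (∑ k ∈ S, (γ k * (2 * π * Complex.I * k i * expMode k (Function.update x i (x i)))).re)
      (x i) := by
    refine HasDerivAt.fun_sum fun k _ => ?_
    exact (Complex.reCLM.hasFDerivAt.comp_hasDerivAt (x i)
      ((hasDerivAt_expMode_update k x i (x i)).const_mul (γ k)))
  rw [pder, h.deriv, Function.update_eq_self]
  refine Finset.sum_congr rfl fun k _ => ?_
  congr 1
  ring

theorem integral_mul_trigPoly {v : (Fin d → ℝ) → ℝ} (hv : Continuous v)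
    (S : Finset (Fin d → ℤ)) (γ : (Fin d → ℤ) → ℂ) :
    ∫ x in unitCube d, v x * trigPoly S γ x
      = ∑ k ∈ S, (γ k * (starRingEnd ℂ) (fourCoeff v k)).re := by
  have hintg (k : Fin d → ℤ) : IntegrableOn (fun x => γ k * (expMode k x * (v x : ℂ)))
      (unitCube d) :=
    (continuous_const.mul (continuous_fourCoeff_integrand hv k)).integrableOn_unitCube
  have hterm (k : Fin d → ℤ) : (γ k * (starRingEnd ℂ) (fourCoeff v k)).re
      = ∫ x in unitCube d, (γ k * (expMode k x * (v x : ℂ))).re := by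
    have h1 : (starRingEnd ℂ) (fourCoeff v k)
        = ∫ x in unitCube d, expMode k x * (v x : ℂ) := by
      rw [fourCoeff, ← integral_conj]
      simp [conj_expMode]
    rw [h1, ← integral_const_mul]
    exact (integral_re (hintg k)).symm
  simp only [hterm]
  have hre (k : Fin d → ℤ) : IntegrableOn (fun x => (γ k * (expMode k x * (v x : ℂ))).re)
      (unitCube d) := Complex.reCLM.integrable_comp (hintg k)
  rw [← integral_finsetSum _ fun k _ => hre k]
  refine integral_congr_ae (Eventually.of_forall fun x => ?_)
  beta_reduce
  rw [trigPoly, Finset.mul_sum]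
  refine Finset.sum_congr rfl fun k _ => ?_
  rw [mul_comm (expMode k x), mul_left_comm, Complex.re_ofReal_mul]

theorem sum_sq_fourCoeff_le {v : (Fin d → ℝ) → ℝ} (hv : SmoothPer v) (S : Finset (Fin d → ℤ)) :
    ∑ k ∈ S, ‖fourCoeff v k‖ ^ 2 ≤ ∫ x in unitCube d, (v x) ^ 2 :=
  sum_le_hasSum S (fun _ _ => sq_nonneg _) (hasSum_sq_fourCoeff hv)

theorem integral_trigPoly_sq_le (S : Finset (Fin d → ℤ)) (γ : (Fin d → ℤ) → ℂ) :
    ∫ x in unitCube d, (trigPoly S γ x) ^ 2 ≤ ∑ k ∈ S, ‖γ k‖ ^ 2 := by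
  have hz := smoothPer_trigPoly S γ
  have h1 : ∫ x in unitCube d, (trigPoly S γ x) ^ 2
      ≤ ∑ k ∈ S, (‖γ k‖ ^ 2 / 2 + ‖fourCoeff (trigPoly S γ) k‖ ^ 2 / 2) := by
    simp only [sq (trigPoly S γ _)]
    rw [integral_mul_trigPoly hz.smooth.continuous]
    refine Finset.sum_le_sum fun k _ => (Complex.re_le_norm _).trans ?_
    rw [norm_mul, RCLike.norm_conj]
    nlinarith [sq_nonneg (‖γ k‖ - ‖fourCoeff (trigPoly S γ) k‖)]
  have h2 := sum_sq_fourCoeff_le hz S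
  rw [Finset.sum_add_distrib, ← Finset.sum_div, ← Finset.sum_div] at h1
  linarith

end FourierModes

section SobolevEmbedding

variable {d : ℕ}

theorem summable_norm_intVec_inv_pow (n : ℕ) (hn : d < n) :
    Summable fun k : Fin d → ℤ => ‖fun i => (k i : ℝ)‖⁻¹ ^ n := by
  set L := Submodule.span ℤ (Set.range (Pi.basisFun ℝ (Fin d))) with hL
  have hrank : Module.finrank ℤ L = d := by
    rw [ZLattice.rank ℝ L]
    simp
  have hs := ZLattice.summable_norm_pow_inv L n (by rw [hrank]; exact hn)
  have hmem (k : Fin d → ℤ) : (fun i => (k i : ℝ)) ∈ L := by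
    rw [hL, Module.Basis.mem_span_iff_repr_mem]
    intro i
    exact ⟨k i, by simp⟩
  clear_value L
  have hinj : Function.Injective fun k : Fin d → ℤ => (⟨fun i => (k i : ℝ), hmem k⟩ : L) := by
    intro k k' h
    have h' : (fun i => (k i : ℝ)) = fun i => (k' i : ℝ) := congrArg Subtype.val h
    funext i
    exact_mod_cast congrFun h' i
  have h1 := hs.comp_injective hinj
  simpa only [Function.comp_def, Submodule.coe_norm] using h1

theorem norm_fourCoeff_listDer_replicate {v : (Fin d → ℝ) → ℝ} (hv : SmoothPer v) (i : Fin d)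
    (s : ℕ) (k : Fin d → ℤ) :
    ‖fourCoeff (listDer (List.replicate s i) v) k‖
      = (2 * π * |(k i : ℝ)|) ^ s * ‖fourCoeff v k‖ := by
  induction s with
  | zero => simp [listDer]
  | succ s ih =>
    have : listDer (List.replicate (s + 1) i) v = pder i (listDer (List.replicate s i) v) := rfl
    rw [this, fourCoeff_pder (hv.listDer _), norm_mul, ih]
    simp only [norm_mul, Complex.norm_ofNat, Complex.norm_real, Real.norm_eq_abs,
      abs_of_pos Real.pi_pos, Complex.norm_I, Complex.norm_intCast]
    ring

/-- Sobolev embedding `H^s ⊂ L^∞` on the torus for `s > d / 2`. -/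
theorem exists_sup_bound_of_sobolev (s : ℕ) (hs : d < 2 * s) :
    ∃ A : ℝ, ∀ (B : ℝ) (v : (Fin d → ℝ) → ℝ), SmoothPer v → ∫ x in unitCube d, (v x) ^ 2 ≤ B →
      (∀ i, ∫ x in unitCube d, (listDer (List.replicate s i) v x) ^ 2 ≤ B) →
      ∀ x, |v x| ≤ A + (d + 1) * B := by
  classical
  set q : (Fin d → ℤ) → ℝ := fun k =>
    (if k = 0 then 1 else 0) + ‖fun i => (k i : ℝ)‖⁻¹ ^ (2 * s) with hq
  have hqs : Summable q := by
    refine Summable.add ?_ (summable_norm_intVec_inv_pow (2 * s) hs)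
    exact summable_of_ne_finset_zero (s := {0}) fun k hk => by
      rw [Finset.mem_singleton] at hk
      simp [hk]
  refine ⟨∑' k, q k, fun B v hv h0 hi x => ?_⟩
  set P : (Fin d → ℤ) → ℝ := fun k => ‖fourCoeff v k‖ ^ 2
    + ∑ i, ‖fourCoeff (listDer (List.replicate s i) v) k‖ ^ 2 with hP
  have hPs : HasSum P ((∫ x in unitCube d, (v x) ^ 2)
      + ∑ i, ∫ x in unitCube d, (listDer (List.replicate s i) v x) ^ 2) :=
    (hasSum_sq_fourCoeff hv).add (hasSum_sum fun i _ => hasSum_sq_fourCoeff (hv.listDer _))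
  have hle (k : Fin d → ℤ) : ‖fourCoeff v k‖ ≤ q k + P k := by
    have hsum0 : 0 ≤ ∑ i, ‖fourCoeff (listDer (List.replicate s i) v) k‖ ^ 2 :=
      Finset.sum_nonneg fun _ _ => sq_nonneg _
    by_cases hk : k = 0
    · have h1 : 1 ≤ q k := by
        simp only [hq, hk, if_true]
        have : 0 ≤ ‖fun i : Fin d => (((0 : Fin d → ℤ) i : ℤ) : ℝ)‖⁻¹ ^ (2 * s) := by positivity
        linarith
      nlinarith [sq_nonneg (‖fourCoeff v k‖ - 1), sq_nonneg ‖fourCoeff v k‖]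
    · obtain ⟨j, hj⟩ := Function.ne_iff.1 hk
      obtain ⟨i, -, hmax⟩ := Finset.exists_max_image Finset.univ (fun i => |(k i : ℝ)|)
        ⟨j, Finset.mem_univ j⟩
      have hnorm : ‖fun i => (k i : ℝ)‖ ≤ |(k i : ℝ)| :=
        (pi_norm_le_iff_of_nonneg (abs_nonneg _)).2 fun l => hmax l (Finset.mem_univ l)
      have hpos : 0 < ‖fun i => (k i : ℝ)‖ := by
        refine norm_pos_iff.2 fun h => hj ?_
        have := congrFun h j
        simpa using this
      set N := ‖fun i => (k i : ℝ)‖ with hN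
      have h2 : N ^ s * ‖fourCoeff v k‖ ≤ ‖fourCoeff (listDer (List.replicate s i) v) k‖ := by
        rw [norm_fourCoeff_listDer_replicate hv]
        refine mul_le_mul_of_nonneg_right (pow_le_pow_left₀ hpos.le ?_ s) (norm_nonneg _)
        nlinarith [Real.pi_gt_three, abs_nonneg (k i : ℝ)]
      have h3 : ‖fourCoeff v k‖
          ≤ N⁻¹ ^ s * ‖fourCoeff (listDer (List.replicate s i) v) k‖ := by
        rw [inv_pow, inv_mul_eq_div, le_div_iff₀ (pow_pos hpos s), mul_comm]
        exact h2
      have h4 : ‖fourCoeff (listDer (List.replicate s i) v) k‖ ^ 2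
          ≤ ∑ i, ‖fourCoeff (listDer (List.replicate s i) v) k‖ ^ 2 :=
        Finset.single_le_sum
          (f := fun i => ‖fourCoeff (listDer (List.replicate s i) v) k‖ ^ 2)
          (fun _ _ => sq_nonneg _) (Finset.mem_univ i)
      have h5 : N⁻¹ ^ (2 * s) = (N⁻¹ ^ s) ^ 2 := by rw [mul_comm, pow_mul]
      simp only [hq, hP, hk, if_false, ← hN, h5, zero_add]
      nlinarith [sq_nonneg (N⁻¹ ^ s - ‖fourCoeff (listDer (List.replicate s i) v) k‖),
        sq_nonneg ‖fourCoeff v k‖, sq_nonneg (N⁻¹ ^ s),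
        sq_nonneg ‖fourCoeff (listDer (List.replicate s i) v) k‖]
  have hs' : Summable fun k => ‖fourCoeff v k‖ :=
    Summable.of_nonneg_of_le (fun _ => norm_nonneg _) hle (hqs.add hPs.summable)
  refine (abs_le_tsum_norm_fourCoeff hv hs' x).trans ?_
  refine (hs'.tsum_le_tsum hle (hqs.add hPs.summable)).trans ?_
  rw [hqs.tsum_add hPs.summable, hPs.tsum_eq]
  have h6 : ∑ i, ∫ x in unitCube d, (listDer (List.replicate s i) v x) ^ 2 ≤ d * B := by
    refine (Finset.sum_le_sum fun i _ => hi i).trans (le_of_eq ?_)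
    simp
  linarith

/-- A pointwise bound on a function and its spatial derivatives of order at most two. -/
structure C2Bound (K : ℝ) (v : (Fin d → ℝ) → ℝ) : Prop where
  val : ∀ x, |v x| ≤ K
  der : ∀ i x, |pder i v x| ≤ K
  der₂ : ∀ i j x, |pder i (pder j v) x| ≤ K

theorem exists_c2Bound_of_hSob (β : ℕ) (hβ : 2 + (d : ℝ) / 2 < (β : ℝ)) (R : ℝ) :
    ∃ K : ℝ, ∀ F : (Fin d → ℝ) → ℝ, SmoothPer F → hSob β F ≤ R → C2Bound K F := by
  have hβ2 : 2 ≤ β := by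
    have : (2 : ℝ) < β := lt_of_le_of_lt (by linarith [Nat.cast_nonneg (α := ℝ) d]) hβ
    exact_mod_cast this.le
  obtain ⟨s, rfl⟩ := Nat.exists_eq_add_of_le' hβ2
  have hs : d < 2 * s := by
    push_cast at hβ
    have : (d : ℝ) < 2 * s := by linarith
    exact_mod_cast this
  obtain ⟨A, hA⟩ := exists_sup_bound_of_sobolev s hs
  refine ⟨A + (d + 1) * R ^ 2, fun F hF hR => ?_⟩
  have hsq : hSobSq (s + 2) F ≤ R ^ 2 := (Real.sqrt_le_iff.1 hR).2
  have key (l : List (Fin d)) (hl : l.length ≤ 2) (x : Fin d → ℝ) :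
      |listDer l F x| ≤ A + (d + 1) * R ^ 2 := by
    refine hA (R ^ 2) _ (hF.listDer l) ?_ (fun i => ?_) x
    · exact (integral_listDer_sq_le hF (by lia)).trans hsq
    · have : listDer (List.replicate s i) (listDer l F) = listDer (List.replicate s i ++ l) F := by
        simp only [listDer, List.foldr_append]
      rw [this]
      refine (integral_listDer_sq_le hF ?_).trans hsq
      simp [hl]
  exact ⟨fun x => key [] (by simp) x, fun i x => key [i] (by simp) x,
    fun i j x => key [i, j] (by simp) x⟩

theorem C2Bound.nonneg {K : ℝ} {v : (Fin d → ℝ) → ℝ} (h : C2Bound K v) : 0 ≤ K :=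
  (abs_nonneg _).trans (h.val 0)

theorem pder_pder_mul {v w : (Fin d → ℝ) → ℝ} (hv : ContDiff ℝ (⊤ : ℕ∞) v)
    (hw : ContDiff ℝ (⊤ : ℕ∞) w) (i j : Fin d) :
    pder i (pder j fun x => v x * w x) = fun x =>
      (pder i (pder j v) x * w x + pder j v x * pder i w x)
        + (pder i v x * pder j w x + v x * pder i (pder j w) x) := by
  rw [pder_mul hv hw, pder_add ((contDiff_pder hv j).mul hw) (hv.mul (contDiff_pder hw j)),
    pder_mul (contDiff_pder hv j) hw, pder_mul hv (contDiff_pder hw j)]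

theorem abs_mul_le_mul {a b K L : ℝ} (ha : |a| ≤ K) (hb : |b| ≤ L) : |a * b| ≤ K * L := by
  rw [abs_mul]
  exact mul_le_mul ha hb (abs_nonneg _) ((abs_nonneg _).trans ha)

theorem C2Bound.mul {K L : ℝ} {v w : (Fin d → ℝ) → ℝ} (hv : C2Bound K v) (hw : C2Bound L w)
    (hvs : ContDiff ℝ (⊤ : ℕ∞) v) (hws : ContDiff ℝ (⊤ : ℕ∞) w) :
    C2Bound (4 * (K * L)) fun x => v x * w x := by
  have hKL : 0 ≤ K * L := mul_nonneg hv.nonneg hw.nonneg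
  refine ⟨fun x => ?_, fun i x => ?_, fun i j x => ?_⟩
  · exact (abs_mul_le_mul (hv.val x) (hw.val x)).trans (by linarith)
  · rw [pder_mul hvs hws]
    refine (abs_add_le _ _).trans ?_
    linarith [abs_mul_le_mul (hv.der i x) (hw.val x), abs_mul_le_mul (hv.val x) (hw.der i x)]
  · rw [pder_pder_mul hvs hws]
    refine (abs_add_le _ _).trans ?_
    linarith [abs_add_le (pder i (pder j v) x * w x) (pder j v x * pder i w x),
      abs_add_le (pder i v x * pder j w x) (v x * pder i (pder j w) x),
      abs_mul_le_mul (hv.der₂ i j x) (hw.val x), abs_mul_le_mul (hv.der j x) (hw.der i x),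
      abs_mul_le_mul (hv.der i x) (hw.der j x), abs_mul_le_mul (hv.val x) (hw.der₂ i j x)]

theorem exists_c2Bound_comp {Ψ : ℝ → ℝ} (hΨ : ContDiff ℝ (⊤ : ℕ∞) Ψ) (K : ℝ) :
    ∃ L : ℝ, ∀ v : (Fin d → ℝ) → ℝ, ContDiff ℝ (⊤ : ℕ∞) v → C2Bound K v →
      C2Bound L fun x => Ψ (v x) := by
  have hb {f : ℝ → ℝ} (hf : Continuous f) : ∃ M, ∀ s, |s| ≤ K → |f s| ≤ M := by
    obtain ⟨M, hM⟩ := (isCompact_Icc (a := -K) (b := K)).exists_bound_of_continuousOn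
      hf.continuousOn
    exact ⟨M, fun s hs => hM s (abs_le.1 hs)⟩
  obtain ⟨M₀, h₀⟩ := hb hΨ.continuous
  obtain ⟨M₁, h₁⟩ := hb (contDiff_deriv_top hΨ).continuous
  obtain ⟨M₂, h₂⟩ := hb (contDiff_deriv_top (contDiff_deriv_top hΨ)).continuous
  refine ⟨M₀ + M₁ * K + M₂ * K * K, fun v hv hK => ?_⟩
  have hM₀ : 0 ≤ M₀ := (abs_nonneg _).trans (h₀ _ (hK.val 0))
  have hM₁ : 0 ≤ M₁ := (abs_nonneg _).trans (h₁ _ (hK.val 0))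
  have hM₂ : 0 ≤ M₂ := (abs_nonneg _).trans (h₂ _ (hK.val 0))
  have hK0 := hK.nonneg
  have e₁ : 0 ≤ M₁ * K := mul_nonneg hM₁ hK0
  have e₂ : 0 ≤ M₂ * K * K := mul_nonneg (mul_nonneg hM₂ hK0) hK0
  refine ⟨fun x => ?_, fun i x => ?_, fun i j x => ?_⟩
  · linarith [h₀ _ (hK.val x)]
  · rw [pder_comp hv hΨ]
    linarith [abs_mul_le_mul (h₁ _ (hK.val x)) (hK.der i x)]
  · rw [pder_comp hv hΨ,
      pder_mul (v := fun y => deriv Ψ (v y)) ((contDiff_deriv_top hΨ).comp hv) (contDiff_pder hv j),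
      pder_comp hv (contDiff_deriv_top hΨ)]
    refine (abs_add_le _ _).trans ?_
    linarith [abs_mul_le_mul (abs_mul_le_mul (h₂ _ (hK.val x)) (hK.der i x)) (hK.der j x),
      abs_mul_le_mul (h₁ _ (hK.val x)) (hK.der₂ i j x)]

theorem ZPer.exists_mem_unitCube (x : Fin d → ℝ) :
    ∃ y ∈ unitCube d, ∃ k : Fin d → ℤ, x = fun i => y i + (k i : ℝ) := by
  refine ⟨fun i => Int.fract (x i), ⟨fun i => Int.fract_nonneg _,
    fun i => (Int.fract_lt_one _).le⟩, fun i => ⌊x i⌋, ?_⟩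
  funext i
  exact (Int.fract_add_floor (x i)).symm

theorem SmoothPer.exists_bound {v : (Fin d → ℝ) → ℝ} (hv : SmoothPer v) :
    ∃ M, ∀ x, |v x| ≤ M := by
  obtain ⟨M, hM⟩ := (isCompact_unitCube d).exists_bound_of_continuousOn
    hv.smooth.continuous.continuousOn
  refine ⟨M, fun x => ?_⟩
  obtain ⟨y, hy, k, rfl⟩ := ZPer.exists_mem_unitCube x
  rw [hv.per y k]
  exact hM y hy

theorem SmoothPer.exists_c2Bound {v : (Fin d → ℝ) → ℝ} (hv : SmoothPer v) :
    ∃ K, C2Bound K v := by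
  obtain ⟨M₀, h₀⟩ := hv.exists_bound
  choose M₁ h₁ using fun i => (hv.pder i).exists_bound
  choose M₂ h₂ using fun i j => ((hv.pder j).pder i).exists_bound
  have p₀ : 0 ≤ M₀ := (abs_nonneg _).trans (h₀ 0)
  have p₁ (i) : 0 ≤ M₁ i := (abs_nonneg _).trans (h₁ i 0)
  have p₂ (i j) : 0 ≤ M₂ i j := (abs_nonneg _).trans (h₂ i j 0)
  have s₁ : 0 ≤ ∑ i, M₁ i := Finset.sum_nonneg fun i _ => p₁ i
  have s₂ : 0 ≤ ∑ i, ∑ j, M₂ i j := Finset.sum_nonneg fun i _ =>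
    Finset.sum_nonneg fun j _ => p₂ i j
  refine ⟨M₀ + ∑ i, M₁ i + ∑ i, ∑ j, M₂ i j, fun x => ?_, fun i x => ?_, fun i j x => ?_⟩
  · linarith [h₀ x]
  · linarith [h₁ i x, Finset.single_le_sum (fun i _ => p₁ i) (Finset.mem_univ i)]
  · have := Finset.single_le_sum (f := fun i => ∑ j, M₂ i j)
      (fun i _ => Finset.sum_nonneg fun j _ => p₂ i j) (Finset.mem_univ i)
    have h3 := Finset.single_le_sum (f := fun j => M₂ i j) (fun j _ => p₂ i j)
      (Finset.mem_univ j)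
    linarith [h₂ i j x]

end SobolevEmbedding

section HeatEquation

variable {d : ℕ}

theorem pder_sum {ι : Type*} (s : Finset ι) {v : ι → (Fin d → ℝ) → ℝ}
    (hv : ∀ j ∈ s, ContDiff ℝ (⊤ : ℕ∞) (v j)) (i : Fin d) :
    pder i (fun x => ∑ j ∈ s, v j x) = fun x => ∑ j ∈ s, pder i (v j) x := by
  funext x
  exact (HasDerivAt.fun_sum fun j hj =>
    hasDerivAt_pder ((hv j hj).differentiable_of_top x) i).deriv

theorem contDiff_lap {v : (Fin d → ℝ) → ℝ} (hv : ContDiff ℝ (⊤ : ℕ∞) v) :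
    ContDiff ℝ (⊤ : ℕ∞) (lap v) :=
  ContDiff.sum fun i _ => contDiff_pder (contDiff_pder hv i) i

theorem pder_lap {v : (Fin d → ℝ) → ℝ} (hv : ContDiff ℝ (⊤ : ℕ∞) v) (i : Fin d) :
    pder i (lap v) = lap (pder i v) := by
  unfold lap
  rw [pder_sum _ fun j _ => contDiff_pder (contDiff_pder hv j) j]
  funext x
  refine Finset.sum_congr rfl fun j _ => ?_
  rw [pder_comm (contDiff_pder hv j), pder_comm hv i j]

theorem SmoothQ.space {u : (Fin d → ℝ) → ℝ → ℝ} (hu : SmoothQ u) (t : ℝ) :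
    ContDiff ℝ (⊤ : ℕ∞) fun y => u y t :=
  ContDiff.comp (g := fun p : (Fin d → ℝ) × ℝ => u p.1 p.2) hu
    (contDiff_id.prodMk contDiff_const)

theorem SmoothQ.time {u : (Fin d → ℝ) → ℝ → ℝ} (hu : SmoothQ u) (x : Fin d → ℝ) :
    ContDiff ℝ (⊤ : ℕ∞) (u x) :=
  ContDiff.comp (g := fun p : (Fin d → ℝ) × ℝ => u p.1 p.2) hu
    (contDiff_const.prodMk contDiff_id)

theorem SmoothQ.smoothPer {u : (Fin d → ℝ) → ℝ → ℝ} (hu : SmoothQ u) (hp : ZPerSpace u) (t : ℝ) :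
    SmoothPer fun y => u y t :=
  ⟨hu.space t, hp t⟩

theorem SmoothQ.pder_eq {u : (Fin d → ℝ) → ℝ → ℝ} (hu : SmoothQ u) (i : Fin d) (x : Fin d → ℝ)
    (t : ℝ) : pder i (fun y => u y t) x
      = fderiv ℝ (fun p : (Fin d → ℝ) × ℝ => u p.1 p.2) (x, t) (Pi.single i 1, 0) := by
  rw [pder_eq_fderiv ((hu.space t).differentiable_of_top x)]
  have h1 : HasFDerivAt (fun y : Fin d → ℝ => (y, t)) (ContinuousLinearMap.inl ℝ (Fin d → ℝ) ℝ) x :=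
    hasFDerivAt_prodMk_left x t
  have h2 := (ContDiff.differentiable_of_top hu (x, t)).hasFDerivAt.comp x h1
  exact congrArg (fun L : (Fin d → ℝ) →L[ℝ] ℝ => L (Pi.single i 1)) h2.fderiv

theorem SmoothQ.hasDerivAt {u : (Fin d → ℝ) → ℝ → ℝ} (hu : SmoothQ u) (x : Fin d → ℝ) (t : ℝ) :
    HasDerivAt (u x) (deriv (u x) t) t :=
  ((hu.time x).differentiable_of_top t).hasDerivAt

theorem SmoothQ.deriv_eq {u : (Fin d → ℝ) → ℝ → ℝ} (hu : SmoothQ u) (x : Fin d → ℝ)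
    (t : ℝ) : deriv (u x) t
      = fderiv ℝ (fun p : (Fin d → ℝ) × ℝ => u p.1 p.2) (x, t) (0, 1) := by
  have h1 : HasDerivAt (fun s : ℝ => (x, s)) ((0 : Fin d → ℝ), (1 : ℝ)) t :=
    (hasDerivAt_const t x).prodMk (hasDerivAt_id t)
  exact ((ContDiff.differentiable_of_top hu (x, t)).hasFDerivAt.comp_hasDerivAt t h1).deriv

theorem SmoothQ.pder {u : (Fin d → ℝ) → ℝ → ℝ} (hu : SmoothQ u) (i : Fin d) :
    SmoothQ fun x t => pder i (fun y => u y t) x := by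
  have h : (fun p : (Fin d → ℝ) × ℝ => _root_.pder i (fun y => u y p.2) p.1) = _ :=
    funext fun p => hu.pder_eq i p.1 p.2
  rw [SmoothQ, h]
  exact ContDiff.fderiv_apply_const hu _

theorem SmoothQ.timeDeriv {u : (Fin d → ℝ) → ℝ → ℝ} (hu : SmoothQ u) :
    SmoothQ fun x t => deriv (u x) t := by
  have h : (fun p : (Fin d → ℝ) × ℝ => deriv (u p.1) p.2) = _ :=
    funext fun p => hu.deriv_eq p.1 p.2
  rw [SmoothQ, h]
  exact ContDiff.fderiv_apply_const hu _

theorem SmoothQ.deriv_pder {u : (Fin d → ℝ) → ℝ → ℝ} (hu : SmoothQ u) (i : Fin d)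
    (x : Fin d → ℝ) (t : ℝ) : deriv (fun s => _root_.pder i (fun y => u y s) x) t
      = _root_.pder i (fun y => deriv (u y) t) x := by
  rw [(hu.pder i).deriv_eq, hu.timeDeriv.pder_eq]
  have h1 : (fun p : (Fin d → ℝ) × ℝ => _root_.pder i (fun y => u y p.2) p.1) = _ :=
    funext fun p => hu.pder_eq i p.1 p.2
  have h2 : (fun p : (Fin d → ℝ) × ℝ => deriv (u p.1) p.2) = _ :=
    funext fun p => hu.deriv_eq p.1 p.2
  rw [h1, h2]
  exact fderiv_fderiv_comm hu _ _ _

theorem ZPerSpace.pder {u : (Fin d → ℝ) → ℝ → ℝ} (hu : ZPerSpace u) (i : Fin d) :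
    ZPerSpace fun x t => pder i (fun y => u y t) x :=
  fun t => zper_pder (hu t) i

theorem deriv_deriv_nonpos_of_isMax {φ : ℝ → ℝ} (hφ : ContDiff ℝ (⊤ : ℕ∞) φ) {a : ℝ}
    (ha : ∀ s, φ s ≤ φ a) : deriv (deriv φ) a ≤ 0 := by
  have hmax : IsLocalMax φ a := Eventually.of_forall ha
  by_contra! hpos
  have hmin := isLocalMin_of_deriv_deriv_pos hpos hmax.deriv_eq_zero hφ.continuous.continuousAt
  have hc : φ =ᶠ[nhds a] fun _ => φ a := by
    filter_upwards [hmin] with s hs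
    exact le_antisymm (ha s) hs
  have h2 : deriv φ =ᶠ[nhds a] fun _ => 0 := by
    filter_upwards [hc.deriv] with s hs
    simpa using hs
  rw [h2.deriv_eq] at hpos
  simp at hpos

theorem lap_nonpos_of_isMax {v : (Fin d → ℝ) → ℝ} (hv : ContDiff ℝ (⊤ : ℕ∞) v) {x : Fin d → ℝ}
    (hx : ∀ y, v y ≤ v x) : lap v x ≤ 0 := by
  refine Finset.sum_nonpos fun i _ => ?_
  have h := deriv_deriv_nonpos_of_isMax (φ := fun s => v (Function.update x i s)) (a := x i)
    (hv.comp (contDiff_update _ x i)) fun s => by simpa using hx _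
  have he : deriv (fun s => v (Function.update x i s))
      = fun s => pder i v (Function.update x i s) := by
    funext s
    simp [pder]
  rw [he] at h
  exact h

theorem deriv_nonneg_of_isMax_left {φ : ℝ → ℝ} {a b : ℝ} (hab : a < b)
    (hφ : DifferentiableAt ℝ φ b) (hb : ∀ s ∈ Set.Icc a b, φ s ≤ φ b) : 0 ≤ deriv φ b := by
  have h := (hasDerivWithinAt_iff_tendsto_slope' (Set.self_notMem_Iio (a := b))).1
    hφ.hasDerivAt.hasDerivWithinAt
  refine ge_of_tendsto h ?_
  filter_upwards [Ioo_mem_nhdsLT hab] with s hs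
  rw [slope_def_field]
  exact div_nonneg_of_nonpos (sub_nonpos.2 (hb s ⟨hs.1.le, hs.2.le⟩)) (sub_nonpos.2 hs.2.le)

/-- The weak maximum principle for the forced heat equation with nonnegative absorption. -/
theorem heat_le_of_forcing_le {T θ A B : ℝ} (hθ : 0 ≤ θ) (hA : 0 ≤ A) (hB : 0 ≤ B)
    {f : (Fin d → ℝ) → ℝ} (hf : ∀ x, 0 ≤ f x) {v g : (Fin d → ℝ) → ℝ → ℝ} (hv : SmoothQ v)
    (hp : ZPerSpace v)
    (heq : ∀ x, ∀ t ∈ Set.Ioc (0 : ℝ) T,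
      deriv (v x) t = θ / 2 * lap (fun y => v y t) x - f x * v x t + g x t)
    (hg : ∀ x, ∀ t ∈ Set.Ioc (0 : ℝ) T, g x t ≤ B) (h0 : ∀ x, v x 0 ≤ A) :
    ∀ x, ∀ t ∈ Set.Icc (0 : ℝ) T, v x t ≤ A + B * t := by
  intro x₁ t₁ ht₁
  by_contra! hcon
  obtain ⟨ε, hε, hεv⟩ : ∃ ε > 0, A + (B + ε) * t₁ < v x₁ t₁ := by
    refine ⟨(v x₁ t₁ - (A + B * t₁)) / (2 * (t₁ + 1)), ?_, ?_⟩
    · have := ht₁.1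
      exact div_pos (by linarith) (by linarith)
    · have hpos : 0 < t₁ + 1 := by linarith [ht₁.1]
      have : (v x₁ t₁ - (A + B * t₁)) / (2 * (t₁ + 1)) * t₁ ≤ (v x₁ t₁ - (A + B * t₁)) / 2 := by
        rw [div_mul_eq_mul_div, div_le_div_iff₀ (by linarith) two_pos]
        nlinarith [ht₁.1]
      nlinarith
  set q : (Fin d → ℝ) × ℝ → ℝ := fun p => v p.1 p.2 - (A + (B + ε) * p.2) with hq
  have hqc : Continuous q := (ContDiff.continuous hv).sub (by fun_prop)
  obtain ⟨⟨x₀, t₀⟩, ⟨hx₀, ht₀⟩, hmax⟩ := ((isCompact_unitCube d).prod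
    (isCompact_Icc (a := (0 : ℝ)) (b := T))).exists_isMaxOn
    ⟨(0, t₁), ⟨⟨le_refl _, zero_le_one⟩, ht₁⟩⟩ hqc.continuousOn
  have hmax' (y : Fin d → ℝ) (t : ℝ) (ht : t ∈ Set.Icc 0 T) : q (y, t) ≤ q (x₀, t₀) := by
    obtain ⟨z, hz, k, rfl⟩ := ZPer.exists_mem_unitCube y
    have : q (fun i => z i + (k i : ℝ), t) = q (z, t) := by
      simp only [hq]
      exact congrArg (fun r => r - (A + (B + ε) * t)) (hp t z k)
    rw [this]
    exact hmax (Set.mk_mem_prod hz ht)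
  simp only [hq] at hmax' ht₀
  have hpos : 0 < v x₀ t₀ - (A + (B + ε) * t₀) := by linarith [hmax' x₁ t₁ ht₁]
  have ht₀pos : 0 < t₀ := by
    refine lt_of_le_of_ne ht₀.1 fun h => ?_
    rw [← h] at hpos
    linarith [h0 x₀]
  have hvpos : 0 < v x₀ t₀ := by nlinarith
  have hlap := lap_nonpos_of_isMax (hv.space t₀) (x := x₀) fun y => by
    linarith [hmax' y t₀ ht₀]
  have hd : HasDerivAt (fun s => v x₀ s - (A + (B + ε) * s)) (deriv (v x₀) t₀ - (B + ε)) t₀ := by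
    have h2 : HasDerivAt (fun s => A + (B + ε) * s) (B + ε) t₀ := by
      simpa using ((hasDerivAt_id t₀).const_mul (B + ε)).const_add A
    exact (hv.hasDerivAt x₀ t₀).sub h2
  have hder := deriv_nonneg_of_isMax_left ht₀pos hd.differentiableAt fun s hs =>
    hmax' x₀ s ⟨hs.1, hs.2.trans ht₀.2⟩
  rw [hd.deriv, heq x₀ t₀ ⟨ht₀pos, ht₀.2⟩] at hder
  have h1 := hg x₀ t₀ ⟨ht₀pos, ht₀.2⟩
  have h2 := mul_nonneg (hf x₀) hvpos.le
  nlinarith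

theorem pder_neg (i : Fin d) (v : (Fin d → ℝ) → ℝ) :
    pder i (fun x => -v x) = fun x => -pder i v x := by
  funext x
  simp [pder]

theorem heat_abs_le {T θ A B : ℝ} (hθ : 0 ≤ θ)
    {f : (Fin d → ℝ) → ℝ} (hf : ∀ x, 0 ≤ f x) {v g : (Fin d → ℝ) → ℝ → ℝ} (hv : SmoothQ v)
    (hp : ZPerSpace v)
    (heq : ∀ x, ∀ t ∈ Set.Ioc (0 : ℝ) T,
      deriv (v x) t = θ / 2 * lap (fun y => v y t) x - f x * v x t + g x t)
    (hB : 0 ≤ B) (hg : ∀ x, ∀ t ∈ Set.Ioc (0 : ℝ) T, |g x t| ≤ B) (h0 : ∀ x, |v x 0| ≤ A) :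
    ∀ x, ∀ t ∈ Set.Icc (0 : ℝ) T, |v x t| ≤ A + B * T := by
  have hA : 0 ≤ A := (abs_nonneg _).trans (h0 0)
  intro x t ht
  have h1 := heat_le_of_forcing_le hθ hA hB hf hv hp heq
    (fun x t ht => (le_abs_self _).trans (hg x t ht)) (fun x => (le_abs_self _).trans (h0 x)) x t ht
  have h2 := heat_le_of_forcing_le (v := fun x t => -v x t) (g := fun x t => -g x t)
    hθ hA hB hf (ContDiff.neg hv) (fun t x k => by simpa using hp t x k)
    (fun x t ht => by
      have hl : lap (fun y => -v y t) x = -lap (fun y => v y t) x := by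
        simp only [lap, pder_neg, Finset.sum_neg_distrib]
      have hd : deriv (fun s => -v x s) t = -deriv (v x) t := by simp
      rw [hl, hd, heq x t ht]
      ring)
    (fun x t ht => (neg_le_abs _).trans (hg x t ht)) (fun x => (neg_le_abs _).trans (h0 x)) x t ht
  have h3 : B * t ≤ B * T := mul_le_mul_of_nonneg_left ht.2 hB
  exact abs_le.2 ⟨by linarith, by linarith⟩

/-- The equation solved by a spatial derivative of a solution of the forced heat equation. -/
theorem heat_pder {T θ : ℝ} {f : (Fin d → ℝ) → ℝ} (hf : ContDiff ℝ (⊤ : ℕ∞) f)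
    {v g : (Fin d → ℝ) → ℝ → ℝ} (hv : SmoothQ v) (hg : SmoothQ g)
    (heq : ∀ x, ∀ t ∈ Set.Ioc (0 : ℝ) T,
      deriv (v x) t = θ / 2 * lap (fun y => v y t) x - f x * v x t + g x t) (i : Fin d) :
    ∀ x, ∀ t ∈ Set.Ioc (0 : ℝ) T, deriv (fun s => pder i (fun y => v y s) x) t
      = θ / 2 * lap (pder i fun y => v y t) x - f x * pder i (fun y => v y t) x
        + (pder i (fun y => g y t) x - pder i f x * v x t) := by
  intro x t ht
  have h1 : (fun y => deriv (v y) t)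
      = fun y => θ / 2 * lap (fun y => v y t) y - f y * v y t + g y t :=
    funext fun y => heq y t ht
  have e := hv.space t
  rw [hv.deriv_pder, h1,
    pder_add ((contDiff_const.mul (contDiff_lap e)).sub (hf.mul e)) (hg.space t),
    pder_sub (contDiff_const.mul (contDiff_lap e)) (hf.mul e), pder_const_mul (contDiff_lap e),
    pder_mul hf e, pder_lap e]
  ring

theorem SmoothQ.mul_space {u : (Fin d → ℝ) → ℝ → ℝ} (hu : SmoothQ u) {f : (Fin d → ℝ) → ℝ}
    (hf : ContDiff ℝ (⊤ : ℕ∞) f) : SmoothQ fun x t => f x * u x t :=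
  (hf.comp contDiff_fst).mul hu

/-- An a priori bound for spatial derivatives of order at most two of a heat solution. -/
theorem exists_c2Bound_heatSol {T : ℝ} (hT : 0 ≤ T) (L K : ℝ) :
    ∃ M, ∀ (θ : ℝ) (f u0 : (Fin d → ℝ) → ℝ) (u : (Fin d → ℝ) → ℝ → ℝ), 0 ≤ θ →
      ContDiff ℝ (⊤ : ℕ∞) f → (∀ x, 0 ≤ f x) → C2Bound L f → C2Bound K u0 →
      HeatSol T θ f u0 u → ∀ t ∈ Set.Icc (0 : ℝ) T, C2Bound M fun y => u y t := by
  set K₁ := K + L * K * T with hK₁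
  set K₂ := K + (L * K₁ + L * K + L * K₁) * T with hK₂
  refine ⟨K + K₁ + K₂, fun θ f u0 u hθ hf hf0 hfL hu0 hu t ht => ?_⟩
  obtain ⟨hs, hp, heq, hinit⟩ := hu
  have hL0 := hfL.nonneg
  have hK0 := hu0.nonneg
  have hK₁0 : 0 ≤ K₁ := by positivity
  have hK₂0 : 0 ≤ K₂ := by positivity
  have hinit' : (fun y => u y 0) = u0 := funext hinit
  have heq₀ (x : Fin d → ℝ) (t : ℝ) (ht : t ∈ Set.Ioc 0 T) : deriv (u x) t
      = θ / 2 * lap (fun y => u y t) x - f x * u x t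
        + (fun _ _ => 0 : (Fin d → ℝ) → ℝ → ℝ) x t := by
    rw [heq x t ht, add_zero]
  have b₀ : ∀ x, ∀ t ∈ Set.Icc (0 : ℝ) T, |u x t| ≤ K := by
    have := heat_abs_le (A := K) (B := 0) hθ hf0 hs hp heq₀ le_rfl
      (fun x t _ => by simp) (fun x => by rw [hinit]; exact hu0.val x)
    simpa using this
  have heq₁ := heat_pder hf hs (show SmoothQ fun _ _ => (0 : ℝ) from contDiff_const) heq₀
  have hz (i : Fin d) (x : Fin d → ℝ) : pder i (fun _ : Fin d → ℝ => (0 : ℝ)) x = 0 := by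
    simp [pder]
  simp only [hz, zero_sub] at heq₁
  have b₁ (i : Fin d) : ∀ x, ∀ t ∈ Set.Icc (0 : ℝ) T, |pder i (fun y => u y t) x| ≤ K₁ := by
    refine heat_abs_le hθ hf0 (hs.pder i) (hp.pder i) (heq₁ i) (by positivity)
      (fun x t ht => ?_) (fun x => ?_)
    · rw [abs_neg]
      exact abs_mul_le_mul (hfL.der i x) (b₀ x t ⟨ht.1.le, ht.2⟩)
    · rw [hinit']
      exact hu0.der i x
  have b₂ (i j : Fin d) :
      ∀ x, ∀ t ∈ Set.Icc (0 : ℝ) T, |pder i (pder j fun y => u y t) x| ≤ K₂ := by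
    have hgs : SmoothQ fun x t => -(pder j f x * u x t) :=
      ContDiff.neg (hs.mul_space (contDiff_pder hf j))
    refine heat_abs_le hθ hf0 ((hs.pder j).pder i) ((hp.pder j).pder i)
      (heat_pder hf (hs.pder j) hgs (heq₁ j) i) (by positivity) (fun x t ht => ?_) (fun x => ?_)
    · have ht' : t ∈ Set.Icc 0 T := ⟨ht.1.le, ht.2⟩
      rw [pder_neg, pder_mul (contDiff_pder hf j) (hs.space t)]
      have e1 := abs_mul_le_mul (hfL.der₂ i j x) (b₀ x t ht')
      have e2 := abs_mul_le_mul (hfL.der j x) (b₁ i x t ht')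
      have e3 := abs_mul_le_mul (hfL.der i x) (b₁ j x t ht')
      rw [abs_le] at *
      constructor <;> linarith
    · rw [hinit']
      exact hu0.der₂ i j x
  refine ⟨fun x => ?_, fun i x => ?_, fun i j x => ?_⟩
  · linarith [b₀ x t ht]
  · linarith [b₁ i x t ht]
  · linarith [b₂ i j x t ht]

end HeatEquation

section DualNorm

variable {d : ℕ}

theorem listDer_const_mul {v : (Fin d → ℝ) → ℝ} (hv : SmoothPer v) (c : ℝ) (l : List (Fin d)) :
    listDer l (fun x => c * v x) = fun x => c * listDer l v x := by
  induction l with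
  | nil => rfl
  | cons i l ih =>
    have : listDer (i :: l) (fun x => c * v x) = pder i (listDer l fun x => c * v x) := rfl
    rw [this, ih, pder_const_mul (hv.listDer l).smooth]
    rfl

theorem h2dual_nonneg (D : (Fin d → ℝ) → ℝ) : 0 ≤ h2dual D := by
  refine Real.sSup_nonneg ?_
  rintro r ⟨g, -, -, -, rfl⟩
  exact abs_nonneg _

theorem integral_unitCube_add {v w : (Fin d → ℝ) → ℝ} (hv : Continuous v) (hw : Continuous w) :
    ∫ x in unitCube d, (v x + w x) = (∫ x in unitCube d, v x) + ∫ x in unitCube d, w x :=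
  integral_add hv.integrableOn_unitCube hw.integrableOn_unitCube

theorem abs_integral_mul_le {v w : (Fin d → ℝ) → ℝ} (hv : Continuous v) (hw : Continuous w) :
    |∫ x in unitCube d, v x * w x|
      ≤ ((∫ x in unitCube d, (v x) ^ 2) + ∫ x in unitCube d, (w x) ^ 2) / 2 := by
  have hi : ((∫ x in unitCube d, (v x) ^ 2) + ∫ x in unitCube d, (w x) ^ 2) / 2
      = ∫ x in unitCube d, ((v x) ^ 2 + (w x) ^ 2) / 2 := by
    rw [integral_div, integral_unitCube_add] <;> fun_prop
  have hc : Continuous fun x => ((v x) ^ 2 + (w x) ^ 2) / 2 := by fun_prop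
  rw [hi, abs_le, ← integral_neg]
  constructor
  · exact integral_unitCube_mono hc.neg (hv.mul hw) fun x => by nlinarith [sq_nonneg (v x + w x)]
  · exact integral_unitCube_mono (hv.mul hw) hc fun x => by nlinarith [sq_nonneg (v x - w x)]

theorem bddAbove_h2dual {D : (Fin d → ℝ) → ℝ} (hD : Continuous D) :
    BddAbove {r : ℝ | ∃ g : (Fin d → ℝ) → ℝ, ContDiff ℝ (⊤ : ℕ∞) g ∧ ZPer g ∧ hSob 2 g ≤ 1 ∧
      r = |∫ x in unitCube d, D x * g x|} := by
  refine ⟨((∫ x in unitCube d, (D x) ^ 2) + 1) / 2, ?_⟩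
  rintro r ⟨g, hg, hgp, hg1, rfl⟩
  refine (abs_integral_mul_le hD hg.continuous).trans ?_
  have h1 : ∫ x in unitCube d, (g x) ^ 2 ≤ hSobSq 2 g :=
    integral_listDer_sq_le (l := []) ⟨hg, hgp⟩ (by simp)
  have h2 : hSobSq 2 g ≤ 1 := by simpa using (Real.sqrt_le_iff.1 hg1).2
  linarith

theorem abs_integral_mul_le_h2dual {D φ : (Fin d → ℝ) → ℝ} (hD : Continuous D)
    (hφ : SmoothPer φ) {B c : ℝ} (hc : 0 ≤ c) (hBc : (3 : ℝ) ^ d * B ≤ c ^ 2)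
    (hB : ∀ l : List (Fin d), l.length ≤ 2 → ∫ x in unitCube d, (listDer l φ x) ^ 2 ≤ B) :
    |∫ x in unitCube d, D x * φ x| ≤ h2dual D * c := by
  have key (e : ℝ) (he : c < e) : |∫ x in unitCube d, D x * φ x| ≤ h2dual D * e := by
    have he0 : 0 < e := hc.trans_lt he
    have hg := hφ.const_mul e⁻¹
    have h1 : hSobSq 2 (fun x => e⁻¹ * φ x) ≤ ((2 + 1 : ℕ) : ℝ) ^ d * (e⁻¹ ^ 2 * B) := by
      refine hSobSq_le_of_listDer fun l hl => ?_
      simp only [listDer_const_mul hφ, mul_pow]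
      rw [integral_const_mul]
      exact mul_le_mul_of_nonneg_left (hB l hl) (by positivity)
    have h2 : hSob 2 (fun x => e⁻¹ * φ x) ≤ 1 := by
      refine Real.sqrt_le_iff.2 ⟨zero_le_one, h1.trans ?_⟩
      have : ((2 + 1 : ℕ) : ℝ) ^ d * (e⁻¹ ^ 2 * B) = (3 ^ d * B) / e ^ 2 := by
        norm_num
        field_simp
      rw [this, div_le_iff₀ (by positivity)]
      nlinarith
    have h3 := le_csSup (bddAbove_h2dual hD) ⟨_, hg.smooth, hg.per, h2, rfl⟩
    have h4 : |∫ x in unitCube d, D x * (e⁻¹ * φ x)| = e⁻¹ * |∫ x in unitCube d, D x * φ x| := by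
      have : (fun x => D x * (e⁻¹ * φ x)) = fun x => e⁻¹ * (D x * φ x) := by
        funext x
        ring
      rw [this, integral_const_mul, abs_mul, abs_of_pos (inv_pos.2 he0)]
    rw [h4, inv_mul_le_iff₀ he0] at h3
    rw [mul_comm]
    exact h3
  have ht : Tendsto (fun e => h2dual D * e) (nhdsWithin c (Set.Ioi c)) (nhds (h2dual D * c)) :=
    ((continuous_const.mul continuous_id).tendsto c).mono_left nhdsWithin_le_nhds
  refine ge_of_tendsto ht ?_
  filter_upwards [self_mem_nhdsWithin] with e he
  exact key e he

theorem C2Bound.integral_listDer_mul_sq_le {K B : ℝ} {m z : (Fin d → ℝ) → ℝ} (hm : C2Bound K m)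
    (hms : ContDiff ℝ (⊤ : ℕ∞) m) (hz : SmoothPer z)
    (hB : ∀ l : List (Fin d), l.length ≤ 2 → ∫ x in unitCube d, (listDer l z x) ^ 2 ≤ B)
    (l : List (Fin d)) (hl : l.length ≤ 2) :
    ∫ x in unitCube d, (listDer l (fun x => m x * z x) x) ^ 2 ≤ 16 * K ^ 2 * B := by
  have hms' : ContDiff ℝ (⊤ : ℕ∞) fun x => m x * z x := hms.mul hz.smooth
  have hK2 : 0 ≤ K ^ 2 := sq_nonneg K
  have hB0 : 0 ≤ B := (integral_nonneg fun x => sq_nonneg _).trans (hB [] (by simp))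
  have hprod {a b : ℝ} (ha : |a| ≤ K) : (a * b) ^ 2 ≤ K ^ 2 * b ^ 2 := by
    rw [mul_pow]
    exact mul_le_mul_of_nonneg_right (sq_le_sq.2 (ha.trans (le_abs_self K))) (sq_nonneg b)
  have main (c : ℝ) (hc : 0 ≤ c) (f : (Fin d → ℝ) → ℝ) (hf : Continuous f)
      (l₁ l₂ l₃ l₄ : List (Fin d)) (h₁ : l₁.length ≤ 2) (h₂ : l₂.length ≤ 2) (h₃ : l₃.length ≤ 2)
      (h₄ : l₄.length ≤ 2) (hfle : ∀ x, (f x) ^ 2 ≤ c * ((listDer l₁ z x) ^ 2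
        + (listDer l₂ z x) ^ 2 + (listDer l₃ z x) ^ 2 + (listDer l₄ z x) ^ 2)) :
      ∫ x in unitCube d, (f x) ^ 2 ≤ c * (B + B + B + B) := by
    have hc' (l : List (Fin d)) : Continuous fun x => (listDer l z x) ^ 2 :=
      (hz.listDer l).smooth.continuous.pow 2
    have h12 := (hc' l₁).fun_add (hc' l₂)
    have h123 := h12.fun_add (hc' l₃)
    refine (integral_unitCube_mono (hf.pow 2)
      (continuous_const.fun_mul (h123.fun_add (hc' l₄))) hfle).trans ?_
    rw [integral_const_mul, integral_unitCube_add h123 (hc' l₄), integral_unitCube_add h12 (hc' l₃),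
      integral_unitCube_add (hc' l₁) (hc' l₂)]
    exact mul_le_mul_of_nonneg_left (by linarith [hB _ h₁, hB _ h₂, hB _ h₃, hB _ h₄]) hc
  have e16 : 16 * K ^ 2 * B = (4 * K ^ 2) * (B + B + B + B) := by ring
  rw [e16]
  match l, hl with
  | [], _ =>
    refine main _ (by positivity) _ hms'.continuous [] [] [] [] (by simp) (by simp) (by simp)
      (by simp) fun x => ?_
    have := hprod (b := z x) (hm.val x)
    change (m x * z x) ^ 2 ≤ 4 * K ^ 2 * ((z x) ^ 2 + (z x) ^ 2 + (z x) ^ 2 + (z x) ^ 2)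
    nlinarith [mul_nonneg hK2 (sq_nonneg (z x))]
  | [i], _ =>
    refine main _ (by positivity) _ (contDiff_pder hms' i).continuous [i] [i] [] [] (by simp)
      (by simp) (by simp) (by simp) fun x => ?_
    have h0 := congrFun (pder_mul hms hz.smooth i) x
    have h1 := hprod (b := z x) (hm.der i x)
    have h2 := hprod (b := pder i z x) (hm.val x)
    change (pder i (fun x => m x * z x) x) ^ 2
      ≤ 4 * K ^ 2 * ((pder i z x) ^ 2 + (pder i z x) ^ 2 + (z x) ^ 2 + (z x) ^ 2)
    rw [h0]
    nlinarith [mul_nonneg hK2 (sq_nonneg (z x)), mul_nonneg hK2 (sq_nonneg (pder i z x)),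
      sq_nonneg (pder i m x * z x - m x * pder i z x)]
  | [i, j], _ =>
    refine main _ (by positivity) _ (contDiff_pder (contDiff_pder hms' j) i).continuous
      [] [i] [j] [i, j] (by simp) (by simp) (by simp) (by simp) fun x => ?_
    have h0 := congrFun (pder_pder_mul hms hz.smooth i j) x
    have h1 := hprod (b := z x) (hm.der₂ i j x)
    have h2 := hprod (b := pder i z x) (hm.der j x)
    have h3 := hprod (b := pder j z x) (hm.der i x)
    have h4 := hprod (b := pder i (pder j z) x) (hm.val x)
    change (pder i (pder j fun x => m x * z x) x) ^ 2
      ≤ 4 * K ^ 2 * ((z x) ^ 2 + (pder i z x) ^ 2 + (pder j z x) ^ 2 + (pder i (pder j z) x) ^ 2)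
    have hsq (a b c e : ℝ) :
        (a + b + (c + e)) ^ 2 ≤ 4 * (a ^ 2 + b ^ 2 + c ^ 2 + e ^ 2) := by
      nlinarith [sq_nonneg (a - b), sq_nonneg (a - c), sq_nonneg (a - e), sq_nonneg (b - c),
        sq_nonneg (b - e), sq_nonneg (c - e)]
    rw [h0]
    refine (hsq _ _ _ _).trans ?_
    linarith

theorem C2Bound.convex {K s : ℝ} {F G : (Fin d → ℝ) → ℝ} (hF : C2Bound K F) (hG : C2Bound K G)
    (hFs : ContDiff ℝ (⊤ : ℕ∞) F) (hGs : ContDiff ℝ (⊤ : ℕ∞) G) (hs : s ∈ Set.Icc (0 : ℝ) 1) :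
    C2Bound K fun x => G x + s * (F x - G x) := by
  have key {a b : ℝ} (ha : |a| ≤ K) (hb : |b| ≤ K) : |b + s * (a - b)| ≤ K := by
    rw [abs_le] at *
    constructor <;> nlinarith [hs.1, hs.2]
  have hsub {F G : (Fin d → ℝ) → ℝ} (hFs : ContDiff ℝ (⊤ : ℕ∞) F) (hGs : ContDiff ℝ (⊤ : ℕ∞) G)
      (i : Fin d) : pder i (fun x => G x + s * (F x - G x))
        = fun x => pder i G x + s * (pder i F x - pder i G x) := by
    rw [pder_add hGs (contDiff_const.mul (hFs.sub hGs)), pder_const_mul (hFs.sub hGs),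
      pder_sub hFs hGs]
  refine ⟨fun x => key (hF.val x) (hG.val x), fun i x => ?_, fun i j x => ?_⟩
  · rw [hsub hFs hGs]
    exact key (hF.der i x) (hG.der i x)
  · rw [hsub hFs hGs, hsub (contDiff_pder hFs j) (contDiff_pder hGs j)]
    exact key (hF.der₂ i j x) (hG.der₂ i j x)

theorem exists_integral_comp_sub_comp_mul {Φ : ℝ → ℝ} (hΦ : ContDiff ℝ (⊤ : ℕ∞) Φ)
    {F G w : (Fin d → ℝ) → ℝ} (hF : ContDiff ℝ (⊤ : ℕ∞) F) (hG : ContDiff ℝ (⊤ : ℕ∞) G)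
    (hw : ContDiff ℝ (⊤ : ℕ∞) w) :
    ∃ s ∈ Set.Icc (0 : ℝ) 1, ∫ x in unitCube d, (Φ (F x) - Φ (G x)) * w x
      = ∫ x in unitCube d, (F x - G x) * (deriv Φ (G x + s * (F x - G x)) * w x) := by
  set g : (Fin d → ℝ) → ℝ → ℝ := fun x s => Φ (G x + s * (F x - G x)) * w x with hg
  have hgs : ContDiff ℝ (⊤ : ℕ∞) fun p : (Fin d → ℝ) × ℝ => g p.1 p.2 := by
    refine ContDiff.mul (hΦ.comp ?_) (hw.comp contDiff_fst)
    exact (hG.comp contDiff_fst).add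
      (contDiff_snd.mul ((hF.comp contDiff_fst).sub (hG.comp contDiff_fst)))
  have hd := hasDerivAt_integral_unitCube (hgs.of_le (by exact_mod_cast le_top))
  obtain ⟨s, hs, hse⟩ := exists_hasDerivAt_eq_slope _ _ (zero_lt_one (α := ℝ))
    (fun t _ => (hd t).continuousAt.continuousWithinAt) fun t _ => hd t
  refine ⟨s, ⟨hs.1.le, hs.2.le⟩, ?_⟩
  have hderiv (x : Fin d → ℝ) : deriv (g x) s
      = (F x - G x) * (deriv Φ (G x + s * (F x - G x)) * w x) := by
    have h1 : HasDerivAt (fun s => G x + s * (F x - G x)) (F x - G x) s := by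
      simpa using ((hasDerivAt_id s).mul_const (F x - G x)).const_add (G x)
    have h2 := ((hΦ.differentiable_of_top (G x + s * (F x - G x))).hasDerivAt.comp s h1).mul_const
      (w x)
    refine h2.deriv.trans ?_
    ring
  simp only [hderiv] at hse
  rw [hse, sub_zero, div_one, ← integral_sub]
  · refine integral_congr_ae (Eventually.of_forall fun x => ?_)
    simp only [hg, one_mul, zero_mul, add_zero]
    rw [show G x + (F x - G x) = F x by ring]
    ring
  · exact ((hgs.continuous.comp (continuous_id.prodMk continuous_const))).integrableOn_unitCube
  · exact ((hgs.continuous.comp (continuous_id.prodMk continuous_const))).integrableOn_unitCube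

/-- The difference of two absorptions tested against `u z` is controlled by the dual norm of the
difference of the parameters. -/
theorem exists_abs_integral_comp_sub_le_h2dual {Φ : ℝ → ℝ} (hΦ : ContDiff ℝ (⊤ : ℕ∞) Φ)
    (K M : ℝ) : ∃ C, 0 ≤ C ∧ ∀ F G u z : (Fin d → ℝ) → ℝ, ∀ B, SmoothPer F → SmoothPer G →
      SmoothPer u → SmoothPer z → C2Bound K F → C2Bound K G → C2Bound M u →
      (∀ l : List (Fin d), l.length ≤ 2 → ∫ x in unitCube d, (listDer l z x) ^ 2 ≤ B) →
      |∫ x in unitCube d, (Φ (F x) - Φ (G x)) * (u x * z x)|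
        ≤ h2dual (fun x => F x - G x) * Real.sqrt (C * B) := by
  obtain ⟨L, hL⟩ := exists_c2Bound_comp (d := d) (contDiff_deriv_top hΦ) K
  refine ⟨3 ^ d * (16 * (4 * (L * M)) ^ 2), by positivity,
    fun F G u z B hF hG hu hz hFK hGK huM hB => ?_⟩
  obtain ⟨s, hs, hse⟩ := exists_integral_comp_sub_comp_mul hΦ hF.smooth hG.smooth
    (hu.smooth.mul hz.smooth)
  have hB0 : 0 ≤ B := (integral_nonneg fun x => sq_nonneg _).trans (hB [] (by simp))
  have hFs := hG.add ((hF.sub hG).const_mul s)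
  have hm := hL _ hFs.smooth (hFK.convex hGK hF.smooth hG.smooth hs)
  have hms := hFs.comp (contDiff_deriv_top hΦ)
  have hmu := (hm.mul huM hms.smooth hu.smooth).integral_listDer_mul_sq_le
    (hms.smooth.mul hu.smooth) hz hB
  rw [hse]
  have := abs_integral_mul_le_h2dual (hF.sub hG).smooth.continuous ((hms.mul hu).mul hz)
    (Real.sqrt_nonneg (3 ^ d * (16 * (4 * (L * M)) ^ 2) * B))
    (by rw [Real.sq_sqrt (by positivity)]; linarith) hmu
  simpa only [mul_assoc] using this

end DualNorm

section Energy

variable {d : ℕ}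

/-- The Fourier symbol of `-Δ`. -/
noncomputable def lapSymbol (k : Fin d → ℤ) : ℝ := ∑ i, (2 * π * (k i : ℝ)) ^ 2

theorem lapSymbol_nonneg (k : Fin d → ℤ) : 0 ≤ lapSymbol k :=
  Finset.sum_nonneg fun _ _ => sq_nonneg _

theorem sq_le_lapSymbol (k : Fin d → ℤ) (i : Fin d) : (2 * π * (k i : ℝ)) ^ 2 ≤ lapSymbol k :=
  Finset.single_le_sum (f := fun i => (2 * π * (k i : ℝ)) ^ 2) (fun _ _ => sq_nonneg _)
    (Finset.mem_univ i)

theorem fourCoeff_lap {v : (Fin d → ℝ) → ℝ} (hv : SmoothPer v) (k : Fin d → ℤ) :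
    fourCoeff (lap v) k = -(lapSymbol k : ℂ) * fourCoeff v k := by
  have h : fourCoeff (lap v) k = ∑ i, fourCoeff (pder i (pder i v)) k := by
    unfold fourCoeff
    rw [← integral_finsetSum]
    · simp only [lap, Complex.ofReal_sum, Finset.mul_sum]
    · intro i _
      exact (continuous_fourCoeff_integrand
        ((hv.pder i).pder i).smooth.continuous (-k)).integrableOn_unitCube
  rw [h, lapSymbol, Complex.ofReal_sum, ← Finset.sum_neg_distrib, Finset.sum_mul]
  refine Finset.sum_congr rfl fun i _ => ?_
  rw [fourCoeff_pder (hv.pder i), fourCoeff_pder hv]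
  push_cast
  linear_combination (4 * π ^ 2 * (k i : ℂ) ^ 2 * fourCoeff v k) * Complex.I_sq

theorem SmoothQ.hasDerivAt_fourCoeff {w : (Fin d → ℝ) → ℝ → ℝ} (hw : SmoothQ w)
    (k : Fin d → ℤ) (t : ℝ) : HasDerivAt (fun s => fourCoeff (fun x => w x s) k)
      (fourCoeff (fun x => deriv (w x) t) k) t := by
  have hg : ContDiff ℝ (⊤ : ℕ∞) fun p : (Fin d → ℝ) × ℝ => expMode (-k) p.1 * (w p.1 p.2 : ℂ) :=
    ((contDiff_expMode (-k)).comp contDiff_fst).mul (Complex.ofRealCLM.contDiff.comp hw)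
  have h := hasDerivAt_integral_unitCube (g := fun x s => expMode (-k) x * (w x s : ℂ))
    (hg.of_le (by exact_mod_cast le_top)) t
  have he (x : Fin d → ℝ) : deriv (fun s => expMode (-k) x * (w x s : ℂ)) t
      = expMode (-k) x * ((deriv (w x) t : ℝ) : ℂ) :=
    ((hw.hasDerivAt x t).ofReal_comp.const_mul _).deriv
  simp only [he] at h
  exact h

/-- The truncated resolvent of a function: the trigonometric polynomial with Fourier coefficients
`(lam k)⁻¹ * fourCoeff v k` for `k ∈ S`. -/
noncomputable def resolventPoly (S : Finset (Fin d → ℤ)) (lam : (Fin d → ℤ) → ℝ)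
    (v : (Fin d → ℝ) → ℝ) : (Fin d → ℝ) → ℝ :=
  trigPoly S fun k => ((lam k)⁻¹ : ℝ) * fourCoeff v k

theorem integral_lap_mul_resolventPoly {v : (Fin d → ℝ) → ℝ} (hv : SmoothPer v)
    (S : Finset (Fin d → ℤ)) (lam : (Fin d → ℤ) → ℝ) :
    ∫ x in unitCube d, lap v x * resolventPoly S lam v x
      = -∑ k ∈ S, lapSymbol k * ((lam k)⁻¹ * ‖fourCoeff v k‖ ^ 2) := by
  rw [resolventPoly, integral_mul_trigPoly (contDiff_lap hv.smooth).continuous,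
    ← Finset.sum_neg_distrib]
  refine Finset.sum_congr rfl fun k _ => ?_
  rw [fourCoeff_lap hv]
  have : (((lam k)⁻¹ : ℝ) : ℂ) * fourCoeff v k
      * (starRingEnd ℂ) (-(lapSymbol k : ℂ) * fourCoeff v k)
      = ((-(lapSymbol k * ((lam k)⁻¹ * ‖fourCoeff v k‖ ^ 2)) : ℝ) : ℂ) := by
    rw [map_mul, map_neg, Complex.conj_ofReal]
    push_cast
    rw [← Complex.mul_conj']
    ring
  rw [this, Complex.ofReal_re]

theorem SmoothQ.hasDerivAt_energy {w : (Fin d → ℝ) → ℝ → ℝ} (hw : SmoothQ w)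
    (S : Finset (Fin d → ℤ)) (lam : (Fin d → ℤ) → ℝ) (t : ℝ) :
    HasDerivAt (fun s => ∑ k ∈ S, (lam k)⁻¹ * ‖fourCoeff (fun x => w x s) k‖ ^ 2)
      (2 * ∫ x in unitCube d, deriv (w x) t * resolventPoly S lam (fun x => w x t) x) t := by
  have h := HasDerivAt.fun_sum (u := S) fun k _ =>
    ((hw.hasDerivAt_fourCoeff k t).norm_sq.const_mul (lam k)⁻¹)
  refine h.congr_deriv ?_
  rw [resolventPoly, integral_mul_trigPoly (hw.timeDeriv.space t).continuous, Finset.mul_sum]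
  refine Finset.sum_congr rfl fun k _ => ?_
  rw [Complex.inner, mul_assoc (((lam k)⁻¹ : ℝ) : ℂ), Complex.re_ofReal_mul]
  simp only [Complex.mul_re, Complex.conj_re, Complex.conj_im]
  ring

theorem integral_resolventPoly_sq_le {v : (Fin d → ℝ) → ℝ} (S : Finset (Fin d → ℤ))
    {lam : (Fin d → ℤ) → ℝ} (hlam : ∀ k, 1 ≤ lam k) :
    ∫ x in unitCube d, (resolventPoly S lam v x) ^ 2
      ≤ ∑ k ∈ S, (lam k)⁻¹ * ‖fourCoeff v k‖ ^ 2 := by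
  refine (integral_trigPoly_sq_le S _).trans (Finset.sum_le_sum fun k _ => ?_)
  have h0 : 0 ≤ (lam k)⁻¹ := inv_nonneg.2 (zero_le_one.trans (hlam k))
  have h1 : (lam k)⁻¹ ≤ 1 := inv_le_one_of_one_le₀ (hlam k)
  rw [norm_mul, mul_pow, Complex.norm_real, Real.norm_of_nonneg h0]
  refine mul_le_mul_of_nonneg_right ?_ (sq_nonneg _)
  nlinarith

theorem integral_listDer_resolventPoly_sq_le {v : (Fin d → ℝ) → ℝ} (S : Finset (Fin d → ℤ))
    {lam : (Fin d → ℤ) → ℝ} {A : ℝ} (hlam0 : ∀ k, 0 < lam k)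
    (hlam : ∀ k, 1 + lapSymbol k ≤ A * lam k) (l : List (Fin d)) (hl : l.length ≤ 2) :
    ∫ x in unitCube d, (listDer l (resolventPoly S lam v) x) ^ 2
      ≤ A ^ 2 * ∑ k ∈ S, ‖fourCoeff v k‖ ^ 2 := by
  have main (m : (Fin d → ℤ) → ℂ) (hm : ∀ k, ‖m k‖ ≤ 1 + lapSymbol k) :
      ∫ x in unitCube d, (trigPoly S (fun k => m k * (((lam k)⁻¹ : ℝ) * fourCoeff v k)) x) ^ 2
        ≤ A ^ 2 * ∑ k ∈ S, ‖fourCoeff v k‖ ^ 2 := by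
    refine (integral_trigPoly_sq_le S _).trans ?_
    rw [Finset.mul_sum]
    refine Finset.sum_le_sum fun k _ => ?_
    rw [← mul_assoc, norm_mul, mul_pow]
    refine mul_le_mul_of_nonneg_right (pow_le_pow_left₀ (norm_nonneg _) ?_ 2) (sq_nonneg _)
    rw [norm_mul, Complex.norm_real, Real.norm_of_nonneg (inv_nonneg.2 (hlam0 k).le),
      ← div_eq_mul_inv, div_le_iff₀ (hlam0 k)]
    exact (hm k).trans (hlam k)
  have hn (k : Fin d → ℤ) (i : Fin d) : ‖2 * π * Complex.I * k i‖ = |2 * π * (k i : ℝ)| := by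
    simp only [norm_mul, Complex.norm_ofNat, Complex.norm_real, Real.norm_eq_abs,
      Complex.norm_I, Complex.norm_intCast, abs_mul, Nat.abs_ofNat, mul_one]
  match l, hl with
  | [], _ =>
    have := main (fun _ => 1) fun k => by simpa using lapSymbol_nonneg k
    simp only [one_mul] at this
    exact this
  | [i], _ =>
    have h0 : listDer [i] (resolventPoly S lam v) = _ := pder_trigPoly S _ i
    rw [h0]
    refine main _ fun k => ?_
    rw [hn]
    nlinarith [sq_le_lapSymbol k i, sq_abs (2 * π * (k i : ℝ)),
      sq_nonneg (|2 * π * (k i : ℝ)| - 1), abs_nonneg (2 * π * (k i : ℝ))]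
  | [i, j], _ =>
    have h0 : listDer [i, j] (resolventPoly S lam v) = _ :=
      (congrArg (pder i) (pder_trigPoly S _ j)).trans (pder_trigPoly S _ i)
    rw [h0]
    simp only [← mul_assoc (2 * (π : ℂ) * Complex.I * _) (2 * (π : ℂ) * Complex.I * _)]
    refine main _ fun k => ?_
    rw [norm_mul, hn, hn]
    nlinarith [sq_le_lapSymbol k i, sq_le_lapSymbol k j, sq_abs (2 * π * (k i : ℝ)),
      sq_abs (2 * π * (k j : ℝ)), sq_nonneg (|2 * π * (k i : ℝ)| - |2 * π * (k j : ℝ)|)]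

theorem smoothPer_resolventPoly (S : Finset (Fin d → ℤ)) (lam : (Fin d → ℤ) → ℝ)
    (v : (Fin d → ℝ) → ℝ) : SmoothPer (resolventPoly S lam v) :=
  smoothPer_trigPoly S _

/-- A Grönwall-type integral inequality. -/
theorem integral_exp_mul_le_of_deriv_le {T L b : ℝ} (hT : 0 ≤ T) (hL : 0 ≤ L) (hb : 0 ≤ b)
    {e e' p q : ℝ → ℝ} (he : ∀ t, HasDerivAt e (e' t) t) (hp : Continuous p) (hq : Continuous q)
    (h : ∀ t ∈ Set.Ioo 0 T, e' t ≤ -p t + 1 / 2 * q t + L * e t + b) (h0 : e 0 = 0)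
    (hT0 : 0 ≤ e T) :
    ∫ t in (0 : ℝ)..T, exp (-(L * t)) * p t
      ≤ 1 / 2 * (∫ t in (0 : ℝ)..T, exp (-(L * t)) * q t) + b * T := by
  have hder (t : ℝ) : HasDerivAt (fun t => exp (-(L * t)) * e t)
      (exp (-(L * t)) * (-(L * 1)) * e t + exp (-(L * t)) * e' t) t :=
    (((hasDerivAt_id t).const_mul L).neg.exp).mul (he t)
  set φ : ℝ → ℝ := fun t => 1 / 2 * (exp (-(L * t)) * q t) + b - exp (-(L * t)) * p t with hφ
  have hφc : Continuous φ := by fun_prop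
  have hmain := intervalIntegral.sub_le_integral_of_hasDeriv_right_of_le (φ := φ) hT
    (fun t _ => (hder t).continuousAt.continuousWithinAt)
    (fun t _ => (hder t).hasDerivWithinAt) hφc.continuousOn.integrableOn_Icc (fun t ht => by
      have h1 := mul_le_mul_of_nonneg_left (h t ht) (exp_pos (-(L * t))).le
      have h2 : exp (-(L * t)) ≤ 1 := exp_le_one_iff.2 (by nlinarith [ht.1])
      have h3 := mul_le_mul_of_nonneg_right h2 hb
      simp only [hφ]
      linarith)
  have hintg : ∫ t in (0 : ℝ)..T, φ t = 1 / 2 * (∫ t in (0 : ℝ)..T, exp (-(L * t)) * q t) + b * T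
      - ∫ t in (0 : ℝ)..T, exp (-(L * t)) * p t := by
    simp only [hφ]
    rw [intervalIntegral.integral_sub, intervalIntegral.integral_add,
      intervalIntegral.integral_const_mul, intervalIntegral.integral_const, smul_eq_mul]
    · ring
    all_goals exact Continuous.intervalIntegrable (by fun_prop) _ _
  have hpos := mul_nonneg (exp_pos (-(L * T))).le hT0
  simp only [h0, mul_zero, sub_zero] at hmain
  linarith

/-- Letting the truncation tend to the whole frequency lattice. -/
theorem integral_exp_mul_le_of_forall_finset {T L b : ℝ} {w : (Fin d → ℝ) → ℝ → ℝ}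
    (hw : SmoothQ w) (hp : ZPerSpace w)
    (h : ∀ S : Finset (Fin d → ℤ), ∫ t in (0 : ℝ)..T,
      exp (-(L * t)) * ∑ k ∈ S, ‖fourCoeff (fun x => w x t) k‖ ^ 2 ≤ b) :
    ∫ t in (0 : ℝ)..T, exp (-(L * t)) * ∫ x in unitCube d, (w x t) ^ 2 ≤ b := by
  have hc (k : Fin d → ℤ) : Continuous fun t => fourCoeff (fun x => w x t) k :=
    continuous_iff_continuousAt.2 fun t => (hw.hasDerivAt_fourCoeff k t).continuousAt
  have hW : Continuous fun t => ∫ x in unitCube d, (w x t) ^ 2 :=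
    continuous_integral_unitCube (g := fun x t => (w x t) ^ 2) ((ContDiff.continuous hw).pow 2)
  refine le_of_tendsto (intervalIntegral.tendsto_integral_filter_of_dominated_convergence
    (l := (atTop : Filter (Finset (Fin d → ℤ))))
    (fun t => exp (-(L * t)) * ∫ x in unitCube d, (w x t) ^ 2) ?_ ?_ ?_ ?_)
    (Eventually.of_forall h)
  · refine Eventually.of_forall fun S => Continuous.aestronglyMeasurable ?_
    fun_prop
  · refine Eventually.of_forall fun S => Eventually.of_forall fun t _ => ?_
    rw [Real.norm_of_nonneg (mul_nonneg (exp_pos _).le (Finset.sum_nonneg fun _ _ => sq_nonneg _))]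
    exact mul_le_mul_of_nonneg_left (sum_sq_fourCoeff_le (hw.smoothPer hp t) S) (exp_pos _).le
  · exact Continuous.intervalIntegrable (by fun_prop) _ _
  · exact Eventually.of_forall fun t _ =>
      Tendsto.const_mul _ (hasSum_sq_fourCoeff (hw.smoothPer hp t))

end Energy

section Stability

variable {d : ℕ}

theorem C2Bound.abs_lap_le {K : ℝ} {v : (Fin d → ℝ) → ℝ} (h : C2Bound K v) (x : Fin d → ℝ) :
    |lap v x| ≤ d * K := by
  refine (Finset.abs_sum_le_sum_abs _ _).trans
    ((Finset.sum_le_sum fun i _ => h.der₂ i i x).trans (le_of_eq ?_))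
  simp

theorem integral_sq_le_of_abs_le {v w : (Fin d → ℝ) → ℝ} {K : ℝ} (hv : Continuous v)
    (hw : Continuous w) (h : ∀ x, |v x| ≤ K) :
    ∫ x in unitCube d, (v x * w x) ^ 2 ≤ K ^ 2 * ∫ x in unitCube d, (w x) ^ 2 := by
  rw [← integral_const_mul]
  refine integral_unitCube_mono (by fun_prop) (by fun_prop) fun x => ?_
  rw [mul_pow]
  exact mul_le_mul_of_nonneg_right (sq_le_sq.2 ((h x).trans (le_abs_self K))) (sq_nonneg _)

/-- The energy inequality, in the norm dual to the graph norm, for the difference of two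
solutions. -/
theorem two_mul_integral_mul_resolventPoly_le {θ δ L D h C A : ℝ} (hθ : 0 ≤ θ) (hC : 0 ≤ C)
    {v u f g p : (Fin d → ℝ) → ℝ} (hv : SmoothPer v) (hu : SmoothPer u) (hf : Continuous f)
    (hg : Continuous g) (hfL : ∀ x, |f x| ≤ L) (huD : ∀ x, |lap u x| ≤ D)
    (hp : ∀ x, p x = θ / 2 * lap v x - f x * v x + δ / 2 * lap u x - g x * u x)
    (S : Finset (Fin d → ℤ))
    (hA : ∀ k : Fin d → ℤ, 1 + lapSymbol k ≤ A * (1 + θ / 2 * lapSymbol k))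
    (hdual : ∀ (z : (Fin d → ℝ) → ℝ) (B : ℝ), SmoothPer z →
      (∀ l : List (Fin d), l.length ≤ 2 → ∫ x in unitCube d, (listDer l z x) ^ 2 ≤ B) →
      |∫ x in unitCube d, g x * (u x * z x)| ≤ h * Real.sqrt (C * B)) :
    2 * ∫ x in unitCube d, p x * resolventPoly S (fun k => 1 + θ / 2 * lapSymbol k) v x
      ≤ -(∑ k ∈ S, ‖fourCoeff v k‖ ^ 2) + 1 / 2 * (∫ x in unitCube d, (v x) ^ 2)
        + (3 + 2 * L ^ 2) * (∑ k ∈ S, (1 + θ / 2 * lapSymbol k)⁻¹ * ‖fourCoeff v k‖ ^ 2)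
        + (D ^ 2 * δ ^ 2 / 2 + C * A ^ 2 * h ^ 2) := by
  set lam : (Fin d → ℤ) → ℝ := fun k => 1 + θ / 2 * lapSymbol k with hlam
  have hlam1 (k : Fin d → ℤ) : 1 ≤ lam k := by
    have := mul_nonneg (by linarith : 0 ≤ θ / 2) (lapSymbol_nonneg k)
    simp only [hlam]
    linarith
  have hz := smoothPer_resolventPoly S lam v
  have hzE := integral_resolventPoly_sq_le (v := v) S hlam1
  have hzlap := integral_lap_mul_resolventPoly hv S lam
  have hzder := integral_listDer_resolventPoly_sq_le (v := v) S
    (fun k => zero_lt_one.trans_le (hlam1 k)) hA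
  set z := resolventPoly S lam v with hzdef
  set P := ∑ k ∈ S, ‖fourCoeff v k‖ ^ 2
  change _ ≤ -P + _ + _ * (∑ k ∈ S, (lam k)⁻¹ * ‖fourCoeff v k‖ ^ 2) + _
  set E := ∑ k ∈ S, (lam k)⁻¹ * ‖fourCoeff v k‖ ^ 2
  have hP : 0 ≤ P := Finset.sum_nonneg fun _ _ => sq_nonneg _
  have hE : 0 ≤ E := Finset.sum_nonneg fun k _ =>
    mul_nonneg (inv_nonneg.2 (zero_le_one.trans (hlam1 k))) (sq_nonneg _)
  have hsymb : θ * ∑ k ∈ S, lapSymbol k * ((lam k)⁻¹ * ‖fourCoeff v k‖ ^ 2) = 2 * P - 2 * E := by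
    rw [Finset.mul_sum, Finset.mul_sum, Finset.mul_sum, ← Finset.sum_sub_distrib]
    refine Finset.sum_congr rfl fun k _ => ?_
    have hk : lam k * (lam k)⁻¹ = 1 := mul_inv_cancel₀ (zero_lt_one.trans_le (hlam1 k)).ne'
    have hk' : lam k = 1 + θ / 2 * lapSymbol k := rfl
    linear_combination (2 * ‖fourCoeff v k‖ ^ 2) * hk
      - (2 * ‖fourCoeff v k‖ ^ 2 * (lam k)⁻¹) * hk'
  have hvc := hv.smooth.continuous
  have huc := hu.smooth.continuous
  have hzc := hz.smooth.continuous
  have hlv := (contDiff_lap hv.smooth).continuous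
  have hlu := (contDiff_lap hu.smooth).continuous
  have hsplit : ∫ x in unitCube d, p x * z x = θ / 2 * (∫ x in unitCube d, lap v x * z x)
      + -1 / 2 * (∫ x in unitCube d, v x * (2 * f x * z x))
      + (1 / 2 * (∫ x in unitCube d, (lap u x * δ) * z x)
      + -1 * ∫ x in unitCube d, g x * (u x * z x)) := by
    simp only [← integral_const_mul]
    rw [← integral_unitCube_add (by fun_prop) (by fun_prop),
      ← integral_unitCube_add (by fun_prop) (by fun_prop),
      ← integral_unitCube_add (by fun_prop) (by fun_prop)]
    refine integral_congr_ae (Eventually.of_forall fun x => ?_)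
    simp only [hp]
    ring
  have hfz : ∫ x in unitCube d, (2 * f x * z x) ^ 2 ≤ (2 * L) ^ 2 * E :=
    (integral_sq_le_of_abs_le (v := fun x => 2 * f x) (K := 2 * L) (by fun_prop) hzc fun x => by
      rw [abs_mul, abs_two]
      linarith [hfL x]).trans (mul_le_mul_of_nonneg_left hzE (sq_nonneg _))
  have hu2 : ∫ x in unitCube d, (lap u x * δ) ^ 2 ≤ D ^ 2 * δ ^ 2 := by
    refine (integral_sq_le_of_abs_le hlu (w := fun _ => δ) (by fun_prop) huD).trans (le_of_eq ?_)
    rw [integral_unitCube_const]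
  have h1 := (abs_le.1 (abs_integral_mul_le hvc (w := fun x => 2 * f x * z x) (by fun_prop))).1
  have h2 := (abs_le.1 (abs_integral_mul_le (v := fun x => lap u x * δ) (by fun_prop) hzc)).2
  have h3 := (abs_le.1 (hdual z (A ^ 2 * P) hz hzder)).1
  have h4 : 2 * (h * Real.sqrt (C * (A ^ 2 * P))) ≤ P + C * A ^ 2 * h ^ 2 := by
    have hs := Real.sq_sqrt (mul_nonneg hC (sq_nonneg A))
    have hs' := Real.sq_sqrt hP
    rw [← mul_assoc C, Real.sqrt_mul (mul_nonneg hC (sq_nonneg A))]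
    nlinarith [sq_nonneg (h * Real.sqrt (C * A ^ 2) - Real.sqrt P)]
  rw [hsplit, hzlap]
  nlinarith

end Stability

section ForwardMap

variable {d : ℕ}

theorem lap_sub {v w : (Fin d → ℝ) → ℝ} (hv : ContDiff ℝ (⊤ : ℕ∞) v)
    (hw : ContDiff ℝ (⊤ : ℕ∞) w) (x : Fin d → ℝ) :
    lap (fun y => v y - w y) x = lap v x - lap w x := by
  simp only [lap, ← Finset.sum_sub_distrib]
  refine Finset.sum_congr rfl fun i _ => ?_
  rw [pder_sub hv hw, pder_sub (contDiff_pder hv i) (contDiff_pder hw i)]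

/-- Space-time `L²` bound for the solution of a heat equation with zero initial value whose forcing
is controlled in the norm dual to the graph norm. -/
theorem integral_sq_le_of_heat_forcing {T θ δ L D h C A : ℝ} (hT : 0 ≤ T) (hθ : 0 ≤ θ) (hC : 0 ≤ C)
    {w u : (Fin d → ℝ) → ℝ → ℝ} {f g : (Fin d → ℝ) → ℝ} (hw : SmoothQ w) (hwp : ZPerSpace w)
    (hu : SmoothQ u) (hup : ZPerSpace u) (hf : Continuous f) (hg : Continuous g)
    (hfL : ∀ x, |f x| ≤ L) (huD : ∀ x, ∀ t ∈ Set.Icc 0 T, |lap (fun y => u y t) x| ≤ D)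
    (heq : ∀ x, ∀ t ∈ Set.Ioc 0 T, deriv (w x) t = θ / 2 * lap (fun y => w y t) x - f x * w x t
      + δ / 2 * lap (fun y => u y t) x - g x * u x t)
    (h0 : ∀ x, w x 0 = 0)
    (hA : ∀ k : Fin d → ℤ, 1 + lapSymbol k ≤ A * (1 + θ / 2 * lapSymbol k))
    (hdual : ∀ t ∈ Set.Icc 0 T, ∀ (z : (Fin d → ℝ) → ℝ) (B : ℝ), SmoothPer z →
      (∀ l : List (Fin d), l.length ≤ 2 → ∫ x in unitCube d, (listDer l z x) ^ 2 ≤ B) →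
      |∫ x in unitCube d, g x * (u x t * z x)| ≤ h * Real.sqrt (C * B)) :
    ∫ t in Set.Ioc (0 : ℝ) T, ∫ x in unitCube d, (w x t) ^ 2
      ≤ exp ((3 + 2 * L ^ 2) * T) * (2 * (D ^ 2 * δ ^ 2 / 2 + C * A ^ 2 * h ^ 2) * T) := by
  set Λ := 3 + 2 * L ^ 2
  set b := D ^ 2 * δ ^ 2 / 2 + C * A ^ 2 * h ^ 2
  have hΛ : 0 ≤ Λ := by positivity
  have hc (k : Fin d → ℤ) : Continuous fun t => fourCoeff (fun x => w x t) k :=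
    continuous_iff_continuousAt.2 fun t => (hw.hasDerivAt_fourCoeff k t).continuousAt
  have hW : Continuous fun t => ∫ x in unitCube d, (w x t) ^ 2 :=
    continuous_integral_unitCube (g := fun x t => (w x t) ^ 2) ((ContDiff.continuous hw).pow 2)
  have hlam (k : Fin d → ℤ) : 0 ≤ (1 + θ / 2 * lapSymbol k)⁻¹ := by
    have := lapSymbol_nonneg k
    positivity
  have hX := integral_exp_mul_le_of_forall_finset hw hwp (T := T) (L := Λ) fun S =>
    integral_exp_mul_le_of_deriv_le (b := b) hT hΛ (by positivity)
      (hw.hasDerivAt_energy S fun k => 1 + θ / 2 * lapSymbol k)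
      (p := fun t => ∑ k ∈ S, ‖fourCoeff (fun x => w x t) k‖ ^ 2) (by fun_prop) hW
      (fun t ht => two_mul_integral_mul_resolventPoly_le hθ hC (hw.smoothPer hwp t)
        (hu.smoothPer hup t) hf hg hfL (fun x => huD x t ⟨ht.1.le, ht.2.le⟩)
        (fun x => heq x t ⟨ht.1, ht.2.le⟩) S hA (hdual t ⟨ht.1.le, ht.2.le⟩))
      (Finset.sum_eq_zero fun k _ => by simp [fourCoeff, h0])
      (Finset.sum_nonneg fun k _ => mul_nonneg (hlam k) (sq_nonneg _))
  have hmono : ∫ t in (0 : ℝ)..T, ∫ x in unitCube d, (w x t) ^ 2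
      ≤ ∫ t in (0 : ℝ)..T, exp (Λ * T) * (exp (-(Λ * t)) * ∫ x in unitCube d, (w x t) ^ 2) := by
    refine intervalIntegral.integral_mono_on hT (hW.intervalIntegrable _ _)
      (Continuous.intervalIntegrable (by fun_prop) _ _) fun t ht => ?_
    rw [← mul_assoc, ← exp_add]
    exact le_mul_of_one_le_left (integral_nonneg fun x => sq_nonneg _)
      (one_le_exp (by nlinarith [ht.2]))
  rw [← intervalIntegral.integral_of_le hT]
  refine hmono.trans ?_
  rw [intervalIntegral.integral_const_mul]
  exact mul_le_mul_of_nonneg_left (by linarith) (exp_pos _).le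

end ForwardMap

/-- joint Lipschitz estimate for the forward map `(θ,F) ↦ K_θ F`
(Lemma `Lipschitz Condition`). -/
theorem forward_map_joint_lipschitz {d : ℕ} (hd : 1 ≤ d) (T θmin θmax : ℝ)
    (hT : 0 < T) (hθmin : 0 < θmin) (hθ : θmin ≤ θmax) (Φ : LinkFun)
    (u0 : (Fin d → ℝ) → ℝ) (hu0 : ContDiff ℝ (⊤ : ℕ∞) u0) (hu0per : ZPer u0)
    (β : ℕ) (hβ : 2 + (d : ℝ) / 2 < (β : ℝ)) (R : ℝ) (hR : 0 < R) :
    ∃ C > (0 : ℝ), ∀ θ₁ ∈ Set.Icc θmin θmax, ∀ θ₂ ∈ Set.Icc θmin θmax,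
      ∀ F₁ F₂ : (Fin d → ℝ) → ℝ,
      ContDiff ℝ (⊤ : ℕ∞) F₁ → ZPer F₁ → hSob β F₁ ≤ R →
      ContDiff ℝ (⊤ : ℕ∞) F₂ → ZPer F₂ → hSob β F₂ ≤ R →
      ∀ u₁ u₂ : (Fin d → ℝ) → ℝ → ℝ,
        HeatSol T θ₁ (fun x => Φ.toFun (F₁ x)) u0 u₁ →
        HeatSol T θ₂ (fun x => Φ.toFun (F₂ x)) u0 u₂ →
        l2Q T (fun x t => u₁ x t - u₂ x t)
          ≤ C * (|θ₁ - θ₂| + h2dual (fun x => F₁ x - F₂ x)) := by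
  obtain ⟨K₀, hK₀⟩ := SmoothPer.exists_c2Bound (v := u0) ⟨hu0, hu0per⟩
  obtain ⟨K, hK⟩ := exists_c2Bound_of_hSob (d := d) β hβ R
  obtain ⟨L, hL⟩ := exists_c2Bound_comp (d := d) Φ.smooth K
  obtain ⟨M, hM⟩ := exists_c2Bound_heatSol (d := d) hT.le L K₀
  obtain ⟨C₁, hC₁, hdual⟩ := exists_abs_integral_comp_sub_le_h2dual (d := d) Φ.smooth K M
  set A := 1 + 2 / θmin with hA
  set c := exp ((3 + 2 * L ^ 2) * T) * (2 * ((d * M) ^ 2 / 2 + C₁ * A ^ 2) * T) with hc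
  have hc0 : 0 ≤ c := by positivity
  refine ⟨Real.sqrt c + 1, by positivity, ?_⟩
  intro θ₁ hθ₁ θ₂ hθ₂ F₁ F₂ hF₁ hF₁p hF₁R hF₂ hF₂p hF₂R u₁ u₂ hu₁ hu₂
  have hΦ0 (s : ℝ) : 0 ≤ Φ.toFun s := (Φ.fmin_pos.trans (Φ.gt_fmin s)).le
  have hK₁ := hK F₁ ⟨hF₁, hF₁p⟩ hF₁R
  have hK₂ := hK F₂ ⟨hF₂, hF₂p⟩ hF₂R
  have hM₂ := hM θ₂ _ u0 u₂ (hθmin.le.trans hθ₂.1) (Φ.smooth.comp hF₂) (fun x => hΦ0 _)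
    (hL F₂ hF₂ hK₂) hK₀ hu₂
  have hθ₁0 : 0 ≤ θ₁ := hθmin.le.trans hθ₁.1
  have hΦc := Φ.smooth.continuous
  have hF₁c := hF₁.continuous
  have hF₂c := hF₂.continuous
  obtain ⟨hs₁, hp₁, heq₁, hi₁⟩ := hu₁
  obtain ⟨hs₂, hp₂, heq₂, hi₂⟩ := hu₂
  set η := h2dual (fun x => F₁ x - F₂ x) with hη
  have hη0 : 0 ≤ η := h2dual_nonneg _
  have key := integral_sq_le_of_heat_forcing (w := fun x t => u₁ x t - u₂ x t) (u := u₂)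
    (f := fun x => Φ.toFun (F₁ x)) (g := fun x => Φ.toFun (F₁ x) - Φ.toFun (F₂ x))
    (θ := θ₁) (δ := θ₁ - θ₂) (L := L) (D := d * M) (h := η) (C := C₁) (A := A)
    hT.le hθ₁0 hC₁ (ContDiff.sub hs₁ hs₂)
    (fun t => ((hs₁.smoothPer hp₁ t).sub (hs₂.smoothPer hp₂ t)).per) hs₂ hp₂ (by fun_prop)
    (by fun_prop) (fun x => (hL F₁ hF₁ hK₁).val x) (fun x t ht => (hM₂ t ht).abs_lap_le x)
    (fun x t ht => by
      rw [lap_sub (hs₁.space t) (hs₂.space t),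
        ((hs₁.hasDerivAt x t).fun_sub (hs₂.hasDerivAt x t)).deriv, heq₁ x t ht, heq₂ x t ht]
      ring)
    (fun x => by rw [hi₁, hi₂, sub_self])
    (fun k => by
      have hX := lapSymbol_nonneg k
      have h1 : 1 ≤ θ₁ / θmin := (one_le_div hθmin).2 hθ₁.1
      have h2 : A * (1 + θ₁ / 2 * lapSymbol k)
          = 1 + 2 / θmin + θ₁ / 2 * lapSymbol k + θ₁ / θmin * lapSymbol k := by
        rw [hA]
        ring
      have h3 := mul_le_mul_of_nonneg_right h1 hX
      have h4 : 0 ≤ 2 / θmin + θ₁ / 2 * lapSymbol k := by positivity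
      linarith)
    (fun t ht z B hz hB => hdual F₁ F₂ _ z B ⟨hF₁, hF₁p⟩ ⟨hF₂, hF₂p⟩ (hs₂.smoothPer hp₂ t) hz
      hK₁ hK₂ (hM₂ t ht) hB)
  have hsum : 0 ≤ |θ₁ - θ₂| + η := by positivity
  have hle : exp ((3 + 2 * L ^ 2) * T)
      * (2 * ((d * M) ^ 2 * (θ₁ - θ₂) ^ 2 / 2 + C₁ * A ^ 2 * η ^ 2) * T)
      ≤ c * (|θ₁ - θ₂| + η) ^ 2 := by
    rw [hc, mul_assoc (exp _) _ ((|θ₁ - θ₂| + η) ^ 2)]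
    refine mul_le_mul_of_nonneg_left ?_ (exp_pos _).le
    have hδ : (θ₁ - θ₂) ^ 2 ≤ (|θ₁ - θ₂| + η) ^ 2 := by
      rw [← sq_abs (θ₁ - θ₂)]
      exact pow_le_pow_left₀ (abs_nonneg _) (le_add_of_nonneg_right hη0) 2
    have hη2 : η ^ 2 ≤ (|θ₁ - θ₂| + η) ^ 2 :=
      pow_le_pow_left₀ hη0 (le_add_of_nonneg_left (abs_nonneg _)) 2
    have e1 := mul_le_mul_of_nonneg_left hδ (by positivity : 0 ≤ (d * M) ^ 2 * T)
    have e2 := mul_le_mul_of_nonneg_left hη2 (by positivity : 0 ≤ 2 * (C₁ * A ^ 2) * T)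
    linarith
  calc l2Q T (fun x t => u₁ x t - u₂ x t)
      ≤ Real.sqrt (c * (|θ₁ - θ₂| + η) ^ 2) := Real.sqrt_le_sqrt (key.trans hle)
    _ = Real.sqrt c * (|θ₁ - θ₂| + η) := by
      rw [Real.sqrt_mul hc0, Real.sqrt_sq hsum]
    _ ≤ (Real.sqrt c + 1) * (|θ₁ - θ₂| + η) :=
      mul_le_mul_of_nonneg_right (by linarith) hsum
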